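/- arXiv:0807.2058 — 3 statements merged into one kernel-verified Lean document; each statement's English description precedes it below -/
import Mathlib

section
/- Let R be an algebraic curvature tensor on an n-dimensional real inner product space (V,g) and k ≥ 1 an integer with 2k ≤ n−2. Define the k-th Newton transformation of R by the explicit formula N_k(R) = c^{2k−2}R^k/(2k−2)! − g·c^{2k−1}R^k/(2k−1)! + g²·c^{2k}R^k/(2·(2k)!), and the 2k-th Einstein–Lovelock tensor by T_{2k} = h_{2k}·g − c^{2k−1}R^k/(2k−1)!. Then N_k(R) is a symmetric (2,2)-double form satisfying the first Bianchi identity, and its contractions satisfy c N_k(R) = (n−2k−1)·T_{2k} and c² N_k(R) = (n−2k)(n−2k−1)·h_{2k}. -/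
/-!
Double forms on an `n`-dimensional real inner product space `(V, g)`, represented
by their components with respect to a (fixed) orthonormal basis: a `(p,q)`-double
form is determined by its values on pairs of increasingly ordered tuples of
distinct basis vectors, i.e. by a function `Finset (Fin n) → Finset (Fin n) → ℝ`
(supported on pairs of sets of cardinalities `p` and `q`).
-/

open Finset

noncomputable section

abbrev DF (n : ℕ) := Finset (Fin n) → Finset (Fin n) → ℝ

namespace DF

variable {n : ℕ}

/-- The sign of the shuffle placing the increasing enumeration of `A` before that of
`B` and reordering increasingly. -/
def shuffleSign (A B : Finset (Fin n)) : ℝ :=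
  (-1 : ℝ) ^ ∑ a ∈ A, (B.filter fun b => b < a).card

/-- The exterior product of double forms (Kulkarni–Nomizu type product), in components. -/
def mul (ω θ : DF n) : DF n := fun S T =>
  ∑ A ∈ S.powerset, ∑ C ∈ T.powerset,
    shuffleSign A (S \ A) * shuffleSign C (T \ C) * ω A C * θ (S \ A) (T \ C)

/-- The `(0,0)`-double form `1`. -/
def one (n : ℕ) : DF n := fun S T => if S = ∅ ∧ T = ∅ then 1 else 0

/-- Powers `ω^k` of a double form with respect to the exterior product. -/
def pow (ω : DF n) : ℕ → DF n
  | 0 => one n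
  | k + 1 => mul (pow ω k) ω

/-- The contraction `c ω`, obtained by summing, over an orthonormal basis, the
insertion of the basis vector as first argument in both slots. -/
def contr (ω : DF n) : DF n := fun S T =>
  ∑ i : Fin n,
    if i ∈ S ∨ i ∈ T then 0
    else shuffleSign {i} S * shuffleSign {i} T * ω (insert i S) (insert i T)

/-- The iterated contraction `c^r`. -/
def contrN (r : ℕ) (ω : DF n) : DF n := contr^[r] ω

/-- The metric `g` as a `(1,1)`-double form (components in an orthonormal basis). -/
def gm (n : ℕ) : DF n := fun S T => if S = T ∧ S.card = 1 then 1 else 0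

/-- The inner product of double forms induced by `g`. -/
def dinner (ω θ : DF n) : ℝ :=
  ∑ S : Finset (Fin n), ∑ T : Finset (Fin n), ω S T * θ S T

/-- The scalar given by a `(0,0)`-double form. -/
def toScalar (ω : DF n) : ℝ := ω ∅ ∅

open scoped Classical in
/-- `σ_k` of a `(1,1)`-double form: the `k`-th elementary symmetric function of the
eigenvalues of the corresponding self-adjoint endomorphism (whose matrix in the
orthonormal basis is the matrix of components). -/
def sigma (k : ℕ) (ω : DF n) : ℝ :=
  if h : (Matrix.of fun i j => ω {i} {j} : Matrix (Fin n) (Fin n) ℝ).IsHermitian then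
    ∑ s ∈ Finset.powersetCard k (Finset.univ : Finset (Fin n)), ∏ i ∈ s, h.eigenvalues i
  else 0

/-- `ω` is a `(p,p)`-double form: its components are supported in bidegree `(p,p)`. -/
def IsDeg (p : ℕ) (ω : DF n) : Prop := ∀ S T, ω S T ≠ 0 → S.card = p ∧ T.card = p

/-- Symmetry of a double form: `ω(a;b) = ω(b;a)`. -/
def IsSymm (ω : DF n) : Prop := ∀ S T, ω S T = ω T S

/-- The first Bianchi identity for a `(p,p)`-double form (in components): the complete
antisymmetrization over the first `p+1` vector arguments vanishes. -/
def FirstBianchi (p : ℕ) (ω : DF n) : Prop :=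
  ∀ U T : Finset (Fin n), U.card = p + 1 → T.card = p - 1 →
    ∑ i ∈ U,
      (if i ∈ T then 0
       else shuffleSign {i} (U.erase i) * shuffleSign {i} T * ω (U.erase i) (insert i T)) = 0

end DF

section Geometry

variable {n : ℕ} {V : Type*} [NormedAddCommGroup V] [InnerProductSpace ℝ V]

/-- The components, in the orthonormal basis `e`, of a `(p,p)`-double form given as a
function of `p + p` vector arguments. -/
def ofForm (e : OrthonormalBasis (Fin n) ℝ V) (p : ℕ)
    (ω : (Fin p → V) → (Fin p → V) → ℝ) : DF n := fun S T =>
  if h : S.card = p ∧ T.card = p then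
    ω (fun i => e ((S.orderIsoOfFin h.1 i : Fin n)))
      (fun i => e ((T.orderIsoOfFin h.2 i : Fin n)))
  else 0

/-- The components of a bilinear form, viewed as a `(1,1)`-double form. -/
def ofBilin (e : OrthonormalBasis (Fin n) ℝ V) (b : V → V → ℝ) : DF n :=
  ofForm e 1 fun x y => b (x 0) (y 0)

/-- The components of a `(2,2)`-double form given as a function of four vectors. -/
def ofCurv (e : OrthonormalBasis (Fin n) ℝ V) (R : V → V → V → V → ℝ) : DF n :=
  ofForm e 2 fun x y => R (x 0) (x 1) (y 0) (y 1)

/-- Bilinearity of a real-valued function of two vector arguments. -/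
def IsBilin (b : V → V → ℝ) : Prop :=
  (∀ (c : ℝ) (x x' y : V), b (c • x + x') y = c * b x y + b x' y) ∧
  (∀ (c : ℝ) (x y y' : V), b x (c • y + y') = c * b x y + b x y')

/-- Symmetry of a bilinear form. -/
def IsSymmBilin (b : V → V → ℝ) : Prop := ∀ x y, b x y = b y x

/-- An algebraic curvature tensor: a multilinear form of four vectors, antisymmetric
in the first two arguments, symmetric under exchange of the two pairs, and satisfying
the first Bianchi identity. -/
structure IsCurv (R : V → V → V → V → ℝ) : Prop where
  linear : ∀ (c : ℝ) (x x' y z w : V), R (c • x + x') y z w = c * R x y z w + R x' y z w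
  antisymm : ∀ x y z w, R x y z w = - R y x z w
  pair_symm : ∀ x y z w, R x y z w = R z w x y
  bianchi : ∀ x y z w, R x y z w + R y z x w + R z x y w = 0

/-- Multilinearity of a real-valued function of `p` vector arguments. -/
def IsMultilinear (p : ℕ) (f : (Fin p → V) → ℝ) : Prop :=
  ∀ (x : Fin p → V) (i : Fin p) (c : ℝ) (u v : V),
    f (Function.update x i (c • u + v)) =
      c * f (Function.update x i u) + f (Function.update x i v)

/-- A function of `p` vector arguments is alternating. -/
def IsAlt (p : ℕ) (f : (Fin p → V) → ℝ) : Prop :=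
  ∀ (x : Fin p → V) (i j : Fin p), i ≠ j → x i = x j → f x = 0

/-- A `(p,p)`-double form, as a function of `p + p` vector arguments:
multilinear and alternating in each of the two blocks of arguments. -/
def IsDoubleForm (p : ℕ) (ω : (Fin p → V) → (Fin p → V) → ℝ) : Prop :=
  (∀ y, IsMultilinear p fun x => ω x y) ∧ (∀ y, IsAlt p fun x => ω x y) ∧
  (∀ x, IsMultilinear p fun y => ω x y) ∧ (∀ x, IsAlt p fun y => ω x y)

/-- Symmetry of a `(p,p)`-double form: `ω(x;y) = ω(y;x)`. -/
def IsSymmForm (p : ℕ) (ω : (Fin p → V) → (Fin p → V) → ℝ) : Prop := ∀ x y, ω x y = ω y x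

/-- The first Bianchi identity for a `(p,p)`-double form of vector arguments:
the complete antisymmetrization over the first `p+1` vector arguments vanishes. -/
def FirstBianchiForm (p : ℕ) (hp : 0 < p) (ω : (Fin p → V) → (Fin p → V) → ℝ) : Prop :=
  ∀ (z : Fin (p + 1) → V) (y : Fin p → V),
    ∑ σ : Equiv.Perm (Fin (p + 1)),
      ((Equiv.Perm.sign σ : ℤ) : ℝ) *
        ω (fun i => z (σ (Fin.castSucc i))) (Function.update y ⟨0, hp⟩ (z (σ (Fin.last p)))) = 0

/-- The scalar curvature `Scal = c²R` of a `(2,2)`-double form (in components). -/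
def scalDF {n : ℕ} (Rd : DF n) : ℝ := DF.toScalar (DF.contrN 2 Rd)

/-- The `2k`-th Gauss–Bonnet curvature `h_{2k} = c^{2k} R^k / (2k)!`. -/
def h2kDF {n : ℕ} (k : ℕ) (Rd : DF n) : ℝ :=
  DF.toScalar (DF.contrN (2 * k) (DF.pow Rd k)) / ((2 * k).factorial : ℝ)

/-- The second Gauss–Bonnet curvature `h₄ = c⁴ R² / 4!`. -/
def h4DF {n : ℕ} (Rd : DF n) : ℝ :=
  DF.toScalar (DF.contrN 4 (DF.pow Rd 2)) / (Nat.factorial 4 : ℝ)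

end Geometry

end

/-- The `k`-th Newton transformation of a `(2,2)`-double form `R`, by its explicit
contraction formula:
`N_k(R) = c^{2k−2}R^k/(2k−2)! − g·c^{2k−1}R^k/(2k−1)! + g²·c^{2k}R^k/(2·(2k)!)`. -/
noncomputable def newtonCurv {n : ℕ} (k : ℕ) (Rd : DF n) : DF n :=
  (((2 * k - 2).factorial : ℕ) : ℝ)⁻¹ • DF.contrN (2 * k - 2) (DF.pow Rd k)
  - DF.mul (DF.gm n) ((((2 * k - 1).factorial : ℕ) : ℝ)⁻¹ • DF.contrN (2 * k - 1) (DF.pow Rd k))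
  + (2 * (((2 * k).factorial : ℕ) : ℝ))⁻¹ •
      DF.mul (DF.pow (DF.gm n) 2) (DF.contrN (2 * k) (DF.pow Rd k))

/-- The `2k`-th Einstein–Lovelock tensor `T_{2k} = h_{2k}·g − c^{2k−1}R^k/(2k−1)!`. -/
noncomputable def lovelock {n : ℕ} (k : ℕ) (Rd : DF n) : DF n :=
  h2kDF k Rd • DF.gm n -
    (((2 * k - 1).factorial : ℕ) : ℝ)⁻¹ • DF.contrN (2 * k - 1) (DF.pow Rd k)


/-! ### Abstract canonical anticommutation relations -/

structure CAR {n : ℕ} {A : Type*} [Ring A] [Algebra ℝ A] (cL aL cR aR : Fin n → A) : Prop where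
  cLcL : ∀ a b, cL a * cL b = - (cL b * cL a)
  cRcR : ∀ a b, cR a * cR b = - (cR b * cR a)
  aRaR : ∀ a b, aR a * aR b = - (aR b * aR a)
  aLcL : ∀ a b, aL a * cL b = (if a = b then 1 else 0) - cL b * aL a
  aRcR : ∀ a b, aR a * cR b = (if a = b then 1 else 0) - cR b * aR a
  comm_cc : ∀ a b, cR a * cL b = cL b * cR a
  comm_ca : ∀ a b, cR a * aL b = aL b * cR a
  comm_ac : ∀ a b, aR a * cL b = cL b * aR a
  comm_aa : ∀ a b, aR a * aL b = aL b * aR a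

namespace CAR

variable {n : ℕ} {A : Type*} [Ring A] [Algebra ℝ A] {cL aL cR aR : Fin n → A}

lemma eq_zero_of_neg {X : Type*} [AddCommGroup X] [Module ℝ X] {x : X} (h : x = -x) : x = 0 := by
  have h2 : (2 : ℝ) • x = 0 := by rw [two_smul]; nth_rewrite 1 [h]; simp
  exact (smul_eq_zero.mp h2).resolve_left two_ne_zero

lemma cL_sq (h : CAR cL aL cR aR) (i : Fin n) : cL i * cL i = 0 := eq_zero_of_neg (h.cLcL i i)
lemma cR_sq (h : CAR cL aL cR aR) (i : Fin n) : cR i * cR i = 0 := eq_zero_of_neg (h.cRcR i i)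
lemma aR_sq (h : CAR cL aL cR aR) (i : Fin n) : aR i * aR i = 0 := eq_zero_of_neg (h.aRaR i i)

lemma B_C (h : CAR cL aL cR aR) : (∑ i, cL i * aR i) * (∑ i, aL i * aR i) = (∑ i, aL i * aR i) * (∑ i, cL i * aR i) := by
  simp only [Finset.sum_mul_sum]
  rw [Finset.sum_comm, ← sub_eq_zero]
  simp only [← Finset.sum_sub_distrib]
  refine Finset.sum_eq_zero fun i _ => Finset.sum_eq_zero fun j _ => ?_
  have e1 : cL j * aR j * (aL i * aR i) = cL j * aL i * (aR j * aR i) := by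
    rw [mul_assoc, ← mul_assoc (aR j), h.comm_aa]; simp only [mul_assoc]
  have e2 : aL i * aR i * (cL j * aR j) = aL i * cL j * (aR i * aR j) := by
    rw [mul_assoc, ← mul_assoc (aR i), h.comm_ac]; simp only [mul_assoc]
  rw [e1, e2, h.aLcL, h.aRaR i j]
  split_ifs with hh
  · subst hh
    simp [h.aR_sq]
  · simp

lemma B_G (h : CAR cL aL cR aR) : (∑ i, cL i * aR i) * (∑ i, cL i * cR i) = (∑ i, cL i * cR i) * (∑ i, cL i * aR i) := by
  simp only [Finset.sum_mul_sum]
  rw [Finset.sum_comm, ← sub_eq_zero]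
  simp only [← Finset.sum_sub_distrib]
  refine Finset.sum_eq_zero fun i _ => Finset.sum_eq_zero fun j _ => ?_
  have e1 : cL j * aR j * (cL i * cR i) = cL j * cL i * (aR j * cR i) := by
    rw [mul_assoc, ← mul_assoc (aR j), h.comm_ac]; simp only [mul_assoc]
  have e2 : cL i * cR i * (cL j * aR j) = cL i * cL j * (cR i * aR j) := by
    rw [mul_assoc, ← mul_assoc (cR i), h.comm_cc]; simp only [mul_assoc]
  rw [e1, e2, h.aRcR, h.cLcL i j]
  split_ifs with hh
  · subst hh
    simp [h.cL_sq]
  · simp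

lemma C_G (h : CAR cL aL cR aR) : (∑ i, aL i * aR i) * (∑ i, cL i * cR i) = (∑ i, cL i * cR i) * (∑ i, aL i * aR i) + ∑ i, (1 - cL i * aL i - cR i * aR i) := by
  simp only [Finset.sum_mul_sum]
  rw [Finset.sum_comm, ← sub_eq_iff_eq_add']
  simp only [← Finset.sum_sub_distrib]
  refine Finset.sum_congr rfl fun i _ => ?_
  have : ∀ j, aL j * aR j * (cL i * cR i) - cL i * cR i * (aL j * aR j) =
      if j = i then (1 - cL i * aL i - cR i * aR i) else 0 := by
    intro j
    have e1 : aL j * aR j * (cL i * cR i) = aL j * cL i * (aR j * cR i) := by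
      rw [mul_assoc, ← mul_assoc (aR j), h.comm_ac]; simp only [mul_assoc]
    have e2 : cL i * cR i * (aL j * aR j) = cL i * aL j * (cR i * aR j) := by
      rw [mul_assoc, ← mul_assoc (cR i), h.comm_ca]; simp only [mul_assoc]
    rw [e1, e2, h.aRcR, h.aLcL]
    split_ifs with hh
    · subst hh; noncomm_ring
    · noncomm_ring
  simp [this]


lemma B_mono (h : CAR cL aL cR aR) (i a b c d : Fin n) :
    cL i * aR i * (cL a * cL b * (cR c * cR d)) - cL a * cL b * (cR c * cR d) * (cL i * aR i) =
      (if i = c then cL i * cL a * cL b * cR d else 0) -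
        (if i = d then cL i * cL a * cL b * cR c else 0) := by
  have e1 : cL i * aR i * (cL a * cL b * (cR c * cR d)) =
      cL i * cL a * cL b * (aR i * cR c * cR d) := by
    calc _ = cL i * (aR i * cL a) * cL b * (cR c * cR d) := by noncomm_ring
      _ = cL i * cL a * (aR i * cL b) * (cR c * cR d) := by rw [h.comm_ac]; noncomm_ring
      _ = _ := by rw [h.comm_ac]; noncomm_ring
  have e2 : cL a * cL b * (cR c * cR d) * (cL i * aR i) =
      cL i * cL a * cL b * (cR c * cR d * aR i) := by
    calc _ = cL a * cL b * cR c * (cR d * cL i) * aR i := by noncomm_ring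
      _ = cL a * cL b * (cR c * cL i) * cR d * aR i := by rw [h.comm_cc]; noncomm_ring
      _ = cL a * (cL b * cL i) * cR c * cR d * aR i := by rw [h.comm_cc]; noncomm_ring
      _ = - ((cL a * cL i) * cL b * cR c * cR d * aR i) := by rw [h.cLcL b i]; noncomm_ring
      _ = _ := by rw [h.cLcL a i]; noncomm_ring
  have e3 : aR i * cR c * cR d - cR c * cR d * aR i =
      (if i = c then cR d else 0) - (if i = d then cR c else 0) := by
    rw [h.aRcR, sub_mul, mul_assoc (cR c), h.aRcR i d, mul_sub]
    split_ifs <;> noncomm_ring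
  rw [e1, e2, ← mul_sub, e3, mul_sub]
  split_ifs <;> simp

lemma cyc (h : CAR cL aL cR aR) (a b c : Fin n) : cL c * cL a * cL b = cL a * cL b * cL c := by
  rw [h.cLcL c a, neg_mul, mul_assoc, h.cLcL c b, mul_neg, neg_neg, mul_assoc]

lemma Y_zero (h : CAR cL aL cR aR) (r : Fin n → Fin n → Fin n → ℝ)
    (hb : ∀ a b c, r a b c + r b c a + r c a b = 0) :
    ∑ a, ∑ b, ∑ c, r a b c • (cL c * cL a * cL b) = 0 := by
  set Z := ∑ a, ∑ b, ∑ c, r a b c • (cL c * cL a * cL b) with hZ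
  have z1 : Z = ∑ a, ∑ b, ∑ c, r a b c • (cL a * cL b * cL c) := by
    simp only [hZ, h.cyc]
  have z2 : Z = ∑ a, ∑ b, ∑ c, r b c a • (cL a * cL b * cL c) := by
    rw [z1]
    trans ∑ b, ∑ c, ∑ a, r b c a • (cL b * cL c * cL a)
    · rfl
    · rw [Finset.sum_congr rfl fun b _ => Finset.sum_comm, Finset.sum_comm]
      refine Finset.sum_congr rfl fun a _ => Finset.sum_congr rfl fun b _ =>
        Finset.sum_congr rfl fun c _ => ?_
      rw [h.cyc b c a]
  have z3 : Z = ∑ a, ∑ b, ∑ c, r c a b • (cL a * cL b * cL c) := by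
    rw [z1]
    trans ∑ c, ∑ a, ∑ b, r c a b • (cL c * cL a * cL b)
    · rfl
    · rw [Finset.sum_comm, Finset.sum_congr rfl fun b _ => Finset.sum_comm]
      refine Finset.sum_congr rfl fun a _ => Finset.sum_congr rfl fun b _ =>
        Finset.sum_congr rfl fun c _ => ?_
      rw [h.cyc a b c]
  have z4 : Z + Z + Z = 0 := by
    nth_rewrite 1 [z1]
    nth_rewrite 1 [z2]
    rw [z3]
    simp only [← Finset.sum_add_distrib, ← add_smul, hb]
    simp
  have h3 : (3 : ℝ) • Z = 0 := by
    rw [← z4]; rw [show (3 : ℝ) = 1 + 1 + 1 by norm_num]; simp only [add_smul, one_smul]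
  exact (smul_eq_zero.mp h3).resolve_left three_ne_zero

lemma B_K (h : CAR cL aL cR aR) (r : Fin n → Fin n → Fin n → Fin n → ℝ)
    (hcd : ∀ a b c d, r a b c d = - r a b d c)
    (hb : ∀ a b c d, r a b c d + r b c a d + r c a b d = 0) :
    (∑ i, cL i * aR i) * (∑ a, ∑ b, ∑ c, ∑ d, r a b c d • (cL a * cL b * (cR c * cR d))) =
    (∑ a, ∑ b, ∑ c, ∑ d, r a b c d • (cL a * cL b * (cR c * cR d))) * (∑ i, cL i * aR i) := by
  rw [← sub_eq_zero]
  have e : ∀ a b c d : Fin n,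
      (∑ i, cL i * aR i) * (r a b c d • (cL a * cL b * (cR c * cR d))) -
      (r a b c d • (cL a * cL b * (cR c * cR d))) * (∑ i, cL i * aR i) =
      r a b c d • (cL c * cL a * cL b * cR d) - r a b c d • (cL d * cL a * cL b * cR c) := by
    intro a b c d
    rw [mul_smul_comm, smul_mul_assoc, ← smul_sub, ← smul_sub, Finset.sum_mul, Finset.mul_sum,
      ← Finset.sum_sub_distrib]
    simp only [h.B_mono]
    simp [Finset.sum_sub_distrib]
  generalize (∑ i, cL i * aR i) = B at e ⊢
  simp only [Finset.mul_sum, Finset.sum_mul, ← Finset.sum_sub_distrib, e]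
  simp only [Finset.sum_sub_distrib]
  have y : ∑ a, ∑ b, ∑ c, ∑ d, r a b c d • (cL c * cL a * cL b * cR d) = 0 := by
    have : ∀ d, (∑ a, ∑ b, ∑ c, r a b c d • (cL c * cL a * cL b)) * cR d = 0 := by
      intro d
      rw [h.Y_zero (fun a b c => r a b c d) (fun a b c => hb a b c d), zero_mul]
    rw [← Finset.sum_eq_zero (s := Finset.univ) (fun d _ => this d)]
    simp only [Finset.sum_mul, smul_mul_assoc]
    refine Eq.trans ?_ Finset.sum_comm
    refine Finset.sum_congr rfl fun a _ => ?_
    refine Eq.trans ?_ Finset.sum_comm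
    refine Finset.sum_congr rfl fun b _ => ?_
    rw [Finset.sum_comm]
  have y2 : ∑ a, ∑ b, ∑ c, ∑ d, r a b c d • (cL d * cL a * cL b * cR c) = 0 := by
    rw [← neg_eq_zero, ← y]
    simp only [← Finset.sum_neg_distrib]
    refine Finset.sum_congr rfl fun a _ => Finset.sum_congr rfl fun b _ => ?_
    rw [Finset.sum_comm]
    refine Finset.sum_congr rfl fun c _ => Finset.sum_congr rfl fun d _ => ?_
    rw [hcd a b d c, neg_smul, neg_neg]
  rw [y, y2, sub_zero]

lemma sum_lt {X : Type*} [AddCommGroup X] [Module ℝ X] (f : Fin n → Fin n → X)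
    (hs : ∀ a b, f a b = f b a) (hd : ∀ a, f a a = 0) :
    ∑ a, ∑ b, f a b = (2 : ℝ) • ∑ a, ∑ b, if a < b then f a b else 0 := by
  have : ∀ a b, f a b = (if a < b then f a b else 0) + (if b < a then f b a else 0) := by
    intro a b
    rcases lt_trichotomy a b with h | h | h
    · simp [h, h.not_gt]
    · subst h; simp [hd]
    · simp [h, h.not_gt, hs a b]
  rw [two_smul]
  calc _ = ∑ a, ∑ b, ((if a < b then f a b else 0) + (if b < a then f b a else 0)) :=
        Finset.sum_congr rfl fun a _ => Finset.sum_congr rfl fun b _ => this a b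
    _ = _ := by
        simp only [Finset.sum_add_distrib]
        congr 1
        rw [Finset.sum_comm]

lemma K_eq (h : CAR cL aL cR aR) (r : Fin n → Fin n → Fin n → Fin n → ℝ)
    (hab : ∀ a b c d, r a b c d = - r b a c d)
    (hcd : ∀ a b c d, r a b c d = - r a b d c) :
    (∑ a, ∑ b, ∑ c, ∑ d, r a b c d • (cL a * cL b * (cR c * cR d))) =
    (4 : ℝ) • ∑ a, ∑ b, ∑ c, ∑ d,
      if a < b ∧ c < d then r a b c d • (cL a * cL b * (cR c * cR d)) else 0 := by
  rw [sum_lt]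
  · rw [show (4 : ℝ) = 2 * 2 by norm_num, mul_smul]
    congr 1
    simp only [Finset.smul_sum (r := (2 : ℝ))]
    refine Finset.sum_congr rfl fun a _ => Finset.sum_congr rfl fun b _ => ?_
    split_ifs with hlt
    · rw [sum_lt]
      · simp only [hlt, true_and, Finset.smul_sum]
      · intro c d
        rw [hcd, h.cRcR c d]; simp
      · intro c; simp [h.cR_sq]
    · simp [hlt]
  · intro a b
    refine Finset.sum_congr rfl fun c _ => Finset.sum_congr rfl fun d _ => ?_
    rw [hab, h.cLcL a b]; simp
  · intro a; simp [h.cL_sq]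

lemma B_M (h : CAR cL aL cR aR) (r : Fin n → Fin n → Fin n → Fin n → ℝ)
    (hab : ∀ a b c d, r a b c d = - r b a c d)
    (hcd : ∀ a b c d, r a b c d = - r a b d c)
    (hb : ∀ a b c d, r a b c d + r b c a d + r c a b d = 0) :
    (∑ i, cL i * aR i) * (∑ a, ∑ b, ∑ c, ∑ d,
      if a < b ∧ c < d then r a b c d • (cL a * cL b * (cR c * cR d)) else 0) =
    (∑ a, ∑ b, ∑ c, ∑ d,
      if a < b ∧ c < d then r a b c d • (cL a * cL b * (cR c * cR d)) else 0) *
      (∑ i, cL i * aR i) := by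
  have k := h.B_K r hcd hb
  rw [h.K_eq r hab hcd, mul_smul_comm, smul_mul_assoc] at k
  exact smul_right_injective A (four_ne_zero (α := ℝ)) k

end CAR

/-! ### Fermionic operators on double forms -/

namespace DFOp

open DF

variable {n : ℕ}

noncomputable def sg (a : Fin n) (S : Finset (Fin n)) : ℝ := (-1 : ℝ) ^ (S.filter fun b => b < a).card

noncomputable def od (a b : Fin n) : ℝ := if b < a then -1 else 1

lemma shuffle_singleton (a : Fin n) (S : Finset (Fin n)) : shuffleSign {a} S = sg a S := by
  simp [shuffleSign, sg]

lemma sg_sq (a : Fin n) (S : Finset (Fin n)) : sg a S * sg a S = 1 := by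
  unfold sg; rw [← pow_add, ← two_mul, pow_mul]; simp

lemma sg_insert (a b : Fin n) (S : Finset (Fin n)) (hb : b ∉ S) :
    sg a (insert b S) = od a b * sg a S := by
  unfold sg od
  rw [Finset.filter_insert]
  split_ifs with h
  · rw [Finset.card_insert_of_notMem (by simp [hb]), pow_succ]; ring
  · simp

lemma sg_erase (a b : Fin n) (S : Finset (Fin n)) (hb : b ∈ S) :
    sg a (S.erase b) = od a b * sg a S := by
  have h := sg_insert a b (S.erase b) (by simp)
  rw [Finset.insert_erase hb] at h
  rw [h, ← mul_assoc]
  have : od a b * od a b = 1 := by unfold od; split_ifs <;> norm_num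
  rw [this, one_mul]

lemma sg_erase_self (a : Fin n) (S : Finset (Fin n)) : sg a (S.erase a) = sg a S := by
  by_cases h : a ∈ S
  · rw [sg_erase a a S h]; simp [od]
  · rw [Finset.erase_eq_of_notMem h]

lemma sg_insert_self (a : Fin n) (S : Finset (Fin n)) : sg a (insert a S) = sg a S := by
  by_cases h : a ∈ S
  · rw [Finset.insert_eq_of_mem h]
  · rw [sg_insert a a S h]; simp [od]

lemma od_anti {a b : Fin n} (h : a ≠ b) : od b a = - od a b := by
  unfold od
  rcases lt_or_gt_of_ne h with h | h
  · simp [h, h.not_gt]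
  · simp [h, h.not_gt]

section one
variable {X : Type*} [AddCommGroup X] [Module ℝ X]

/-- creation -/
noncomputable def cr (a : Fin n) : (Finset (Fin n) → X) →ₗ[ℝ] (Finset (Fin n) → X) where
  toFun f := fun S => if a ∈ S then sg a S • f (S.erase a) else 0
  map_add' f g := by ext S; simp only [Pi.add_apply]; split_ifs <;> simp
  map_smul' r f := by
    ext S; simp only [Pi.smul_apply, RingHom.id_apply]; split_ifs
    · rw [smul_comm]
    · simp

/-- annihilation -/
noncomputable def an (a : Fin n) : (Finset (Fin n) → X) →ₗ[ℝ] (Finset (Fin n) → X) where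
  toFun f := fun S => if a ∈ S then 0 else sg a S • f (insert a S)
  map_add' f g := by ext S; simp only [Pi.add_apply]; split_ifs <;> simp
  map_smul' r f := by
    ext S; simp only [Pi.smul_apply, RingHom.id_apply]; split_ifs
    · simp
    · rw [smul_comm]

lemma cr_apply (a : Fin n) (f : Finset (Fin n) → X) (S) :
    cr a f S = if a ∈ S then sg a S • f (S.erase a) else 0 := rfl
lemma an_apply (a : Fin n) (f : Finset (Fin n) → X) (S) :
    an a f S = if a ∈ S then 0 else sg a S • f (insert a S) := rfl

lemma cr_cr (a b : Fin n) (f : Finset (Fin n) → X) : cr a (cr b f) = - cr b (cr a f) := by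
  ext S
  simp only [cr_apply, Pi.neg_apply, Finset.mem_erase]
  by_cases hab : a = b
  · subst hab; simp
  · have hba : b ≠ a := fun h => hab h.symm
    by_cases ha : a ∈ S <;> by_cases hb : b ∈ S <;> simp [ha, hb, hab, hba]
    rw [sg_erase b a S ha, sg_erase a b S hb, od_anti hab, Finset.erase_right_comm, smul_smul,
      smul_smul, ← neg_smul]
    congr 1; ring

lemma an_an (a b : Fin n) (f : Finset (Fin n) → X) : an a (an b f) = - an b (an a f) := by
  ext S
  simp only [an_apply, Pi.neg_apply, Finset.mem_insert]
  by_cases hab : a = b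
  · subst hab; simp
  · have hba : b ≠ a := fun h => hab h.symm
    by_cases ha : a ∈ S <;> by_cases hb : b ∈ S <;> simp [ha, hb, hab, hba]
    rw [sg_insert b a S ha, sg_insert a b S hb, od_anti hab, Finset.insert_comm, smul_smul,
      smul_smul, ← neg_smul]
    congr 1; ring

lemma an_cr (a b : Fin n) (f : Finset (Fin n) → X) :
    an a (cr b f) = (if a = b then f else 0) - cr b (an a f) := by
  ext S
  simp only [an_apply, cr_apply, Pi.sub_apply, Finset.mem_insert, Finset.mem_erase]
  by_cases hab : a = b
  · subst hab
    by_cases ha : a ∈ S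
    · simp [ha, smul_smul, sg_erase_self, sg_sq]
    · simp [ha, smul_smul, sg_insert_self, sg_sq]
  · have hba : b ≠ a := fun h => hab h.symm
    by_cases ha : a ∈ S <;> by_cases hb : b ∈ S <;> simp [ha, hb, hab, hba]
    rw [sg_insert b a S ha, sg_erase a b S hb, od_anti hab, Finset.erase_insert_of_ne hab,
      smul_smul, smul_smul, ← neg_smul]
    congr 1; ring

end one

/-- left and right operators -/
noncomputable def cL (a : Fin n) : Module.End ℝ (DF n) := cr a
noncomputable def aL (a : Fin n) : Module.End ℝ (DF n) := an a
noncomputable def cR (a : Fin n) : Module.End ℝ (DF n) where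
  toFun ω := fun S => cr a (ω S)
  map_add' f g := by ext S; simp
  map_smul' r f := by ext S; simp
noncomputable def aR (a : Fin n) : Module.End ℝ (DF n) where
  toFun ω := fun S => an a (ω S)
  map_add' f g := by ext S; simp
  map_smul' r f := by ext S; simp

lemma cL_apply (a : Fin n) (ω : DF n) (S T) :
    cL a ω S T = if a ∈ S then sg a S * ω (S.erase a) T else 0 := by
  change (cr a ω S) T = _
  rw [cr_apply]; split_ifs <;> simp
lemma aL_apply (a : Fin n) (ω : DF n) (S T) :
    aL a ω S T = if a ∈ S then 0 else sg a S * ω (insert a S) T := by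
  change (an a ω S) T = _
  rw [an_apply]; split_ifs <;> simp
lemma cR_apply (a : Fin n) (ω : DF n) (S T) :
    cR a ω S T = if a ∈ T then sg a T * ω S (T.erase a) else 0 := rfl
lemma aR_apply (a : Fin n) (ω : DF n) (S T) :
    aR a ω S T = if a ∈ T then 0 else sg a T * ω S (insert a T) := rfl

lemma cLcL (a b : Fin n) : cL a * cL b = - (cL b * cL a) := by
  refine LinearMap.ext fun ω => ?_
  exact cr_cr a b ω
lemma cRcR (a b : Fin n) : cR a * cR b = - (cR b * cR a) := by
  refine LinearMap.ext fun ω => ?_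
  funext S; exact cr_cr a b (ω S)
lemma aLaL (a b : Fin n) : aL a * aL b = - (aL b * aL a) := by
  refine LinearMap.ext fun ω => ?_
  exact an_an a b ω
lemma aRaR (a b : Fin n) : aR a * aR b = - (aR b * aR a) := by
  refine LinearMap.ext fun ω => ?_
  funext S; exact an_an a b (ω S)
lemma aLcL (a b : Fin n) : aL a * cL b = (if a = b then 1 else 0) - cL b * aL a := by
  refine LinearMap.ext fun ω => ?_
  refine (an_cr a b ω).trans ?_
  split_ifs <;> rfl
lemma aRcR (a b : Fin n) : aR a * cR b = (if a = b then 1 else 0) - cR b * aR a := by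
  refine LinearMap.ext fun ω => ?_
  funext S; refine (an_cr a b (ω S)).trans ?_
  split_ifs <;> rfl

lemma comm_cc (a b : Fin n) : cR a * cL b = cL b * cR a := by
  refine LinearMap.ext fun ω => ?_
  funext S T
  simp only [Module.End.mul_apply, cL_apply, cR_apply]; split_ifs <;> ring
lemma comm_ca (a b : Fin n) : cR a * aL b = aL b * cR a := by
  refine LinearMap.ext fun ω => ?_
  funext S T
  simp only [Module.End.mul_apply, aL_apply, cR_apply]; split_ifs <;> ring
lemma comm_ac (a b : Fin n) : aR a * cL b = cL b * aR a := by
  refine LinearMap.ext fun ω => ?_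
  funext S T
  simp only [Module.End.mul_apply, cL_apply, aR_apply]; split_ifs <;> ring
lemma comm_aa (a b : Fin n) : aR a * aL b = aL b * aR a := by
  refine LinearMap.ext fun ω => ?_
  funext S T
  simp only [Module.End.mul_apply, aL_apply, aR_apply]; split_ifs <;> ring

noncomputable def Cop (n : ℕ) : Module.End ℝ (DF n) := ∑ i, aL i * aR i
noncomputable def Gop (n : ℕ) : Module.End ℝ (DF n) := ∑ i, cL i * cR i
noncomputable def Bop (n : ℕ) : Module.End ℝ (DF n) := ∑ i, cL i * aR i

lemma end_sum_apply {ι : Type*} (s : Finset ι) (f : ι → Module.End ℝ (DF n)) (ω : DF n) (S T) :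
    (∑ i ∈ s, f i) ω S T = ∑ i ∈ s, f i ω S T := by
  rw [LinearMap.sum_apply, Finset.sum_apply, Finset.sum_apply]

lemma contr_eq (ω : DF n) : contr ω = Cop n ω := by
  funext S T
  simp only [contr, Cop, end_sum_apply, Module.End.mul_apply, aL_apply, aR_apply, shuffle_singleton]
  refine Finset.sum_congr rfl fun i _ => ?_
  by_cases h1 : i ∈ S <;> by_cases h2 : i ∈ T <;> simp [h1, h2, mul_assoc]

lemma bianchi_of (p : ℕ) (ω : DF n) (h : Bop n ω = 0) : FirstBianchi p ω := by
  intro U T _ _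
  have h2 : Bop n ω U T = 0 := by rw [h]; rfl
  refine Eq.trans ?_ h2
  simp only [Bop, end_sum_apply, Module.End.mul_apply, cL_apply, aR_apply, shuffle_singleton,
    sg_erase_self]
  rw [← Finset.sum_filter_add_sum_filter_not Finset.univ (fun i => i ∈ U)]
  rw [Finset.sum_eq_zero (s := Finset.univ.filter (fun i => ¬ i ∈ U))]
  · simp only [Finset.filter_mem_eq_inter, Finset.univ_inter, add_zero]
    refine Finset.sum_congr rfl fun i hi => ?_
    by_cases h2 : i ∈ T <;> simp [hi, h2, mul_assoc]
  · intro i hi; simp at hi; simp [hi]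

lemma car_all : CAR (cL (n := n)) aL cR aR :=
  ⟨cLcL, cRcR, aRaR, aLcL, aRcR, comm_cc, comm_ca, comm_ac, comm_aa⟩

lemma B_C : Bop n * Cop n = Cop n * Bop n := car_all.B_C
lemma B_G : Bop n * Gop n = Gop n * Bop n := car_all.B_G
lemma C_G : Cop n * Gop n = Gop n * Cop n + ∑ i, (1 - cL i * aL i - cR i * aR i) := car_all.C_G

lemma C_G_deg (p : ℕ) (ω : DF n) (h : IsDeg p ω) :
    Cop n (Gop n ω) = Gop n (Cop n ω) + ((n : ℝ) - 2 * p) • ω := by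
  have h1 := congrArg (fun f => f ω) (C_G (n := n))
  simp only [Module.End.mul_apply, LinearMap.add_apply] at h1
  rw [h1]; congr 1
  funext S T
  rw [end_sum_apply]
  by_cases h0 : ω S T = 0
  · simp only [Pi.smul_apply, h0, smul_zero]
    refine Finset.sum_eq_zero fun i _ => ?_
    simp only [LinearMap.sub_apply, Pi.sub_apply, Module.End.one_apply, Module.End.mul_apply,
      cL_apply, aL_apply, cR_apply, aR_apply, h0]
    by_cases h1 : i ∈ S <;> by_cases h2 : i ∈ T <;> simp [h1, h2, h0]
  · obtain ⟨hS, hT⟩ := h S T h0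
    have : ∀ i, (1 - cL i * aL i - cR i * aR i : Module.End ℝ (DF n)) ω S T =
        (1 - (if i ∈ S then 1 else 0) - (if i ∈ T then 1 else 0)) * ω S T := by
      intro i
      simp only [LinearMap.sub_apply, Pi.sub_apply, Module.End.one_apply, Module.End.mul_apply,
        cL_apply, aL_apply, cR_apply, aR_apply, sg_erase_self]
      have e1 := sg_sq i S
      have e2 := sg_sq i T
      by_cases h1 : i ∈ S <;> by_cases h2 : i ∈ T <;> simp [h1, h2, ← mul_assoc, e1, e2]
    simp only [this, ← Finset.sum_mul, Finset.sum_sub_distrib]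
    simp [hS, hT]
    left; ring

/-! ### Products -/

lemma sum_card_one (S : Finset (Fin n)) (Φ : Finset (Fin n) → Finset (Fin n) → ℝ)
    (h : ∀ A D, A.card ≠ 1 → Φ A D = 0) :
    ∑ A ∈ S.powerset, shuffleSign A (S \ A) * Φ A (S \ A) =
      ∑ a, if a ∈ S then sg a S * Φ {a} (S.erase a) else 0 := by
  rw [← Finset.sum_filter]
  symm
  refine Finset.sum_of_injOn (fun a => {a}) ?_ ?_ ?_ ?_
  · intro a _ b _ hab; simpa using hab
  · intro a ha; simpa using ha
  · intro A hA hA2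
    rw [h A _ , mul_zero]
    intro hc
    obtain ⟨a, rfl⟩ := Finset.card_eq_one.mp hc
    apply hA2
    simp at hA ⊢; exact hA
  · intro a ha
    rw [shuffle_singleton, Finset.sdiff_singleton_eq_erase, sg_erase_self]

lemma shuffle_pair (a b : Fin n) (S : Finset (Fin n)) (hab : a < b) (hb : b ∈ S) :
    shuffleSign (S \ {a, b}) {a, b} = sg a S * sg b (S.erase a) := by
  have key : ∀ c : Fin n, ∀ D : Finset (Fin n), c ∉ D →
      shuffleSign D {c} * sg c D = (-1) ^ D.card := by
    intro c D hc
    unfold shuffleSign sg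
    rw [← pow_add, Finset.card_filter, ← Finset.sum_add_distrib, Finset.card_eq_sum_ones]
    congr 1
    refine Finset.sum_congr rfl fun x hx => ?_
    have : x ≠ c := fun h => hc (h ▸ hx)
    rw [Finset.filter_singleton]
    rcases lt_or_gt_of_ne this with h | h
    · simp [h, h.not_gt]
    · simp [h, h.not_gt]
  have split : shuffleSign (S \ {a, b}) {a, b} =
      shuffleSign (S \ {a, b}) {a} * shuffleSign (S \ {a, b}) {b} := by
    unfold shuffleSign
    rw [← pow_add, ← Finset.sum_add_distrib]
    congr 1
    refine Finset.sum_congr rfl fun x hx => ?_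
    rw [← Finset.card_union_of_disjoint, ← Finset.filter_union]
    · rfl
    · apply Finset.disjoint_filter_filter; simpa using hab.ne
  have hD : S \ {a, b} = (S.erase a).erase b := by ext x; simp; tauto
  have hb' : b ∈ S.erase a := by simp [hb, hab.ne']
  have s1 : sg a (S \ {a, b}) = sg a S := by
    rw [hD, sg_erase a b _ hb', sg_erase_self]; simp [od, hab.not_gt]
  have s2 : sg b (S \ {a, b}) = sg b (S.erase a) := by
    rw [hD, sg_erase_self]
  have k1 := key a (S \ {a, b}) (by simp)
  have k2 := key b (S \ {a, b}) (by simp)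
  rw [s1] at k1
  rw [s2] at k2
  have q1 := sg_sq a S
  have q2 := sg_sq b (S.erase a)
  rw [split]
  have q3 : ((-1 : ℝ) ^ (S \ {a, b}).card) * ((-1 : ℝ) ^ (S \ {a, b}).card) = 1 := by
    rw [← pow_add, ← two_mul, pow_mul]; simp
  generalize shuffleSign (S \ {a, b}) {a} = u at *
  generalize shuffleSign (S \ {a, b}) {b} = v at *
  calc u * v = (u * sg a S) * (v * sg b (S.erase a)) * (sg a S * sg b (S.erase a)) := by
        linear_combination (-u * v) * q1 - u * v * (sg a S * sg a S) * q2
    _ = _ := by rw [k1, k2, q3, one_mul]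

lemma sum_card_two (S : Finset (Fin n)) (Φ : Finset (Fin n) → Finset (Fin n) → ℝ)
    (h : ∀ A D, D.card ≠ 2 → Φ A D = 0) :
    ∑ A ∈ S.powerset, shuffleSign A (S \ A) * Φ A (S \ A) =
      ∑ a, ∑ b, if a < b ∧ a ∈ S ∧ b ∈ S then
        sg a S * sg b (S.erase a) * Φ ((S.erase a).erase b) {a, b} else 0 := by
  rw [← Finset.sum_product', ← Finset.sum_filter]
  symm
  refine Finset.sum_of_injOn (fun p => S \ {p.1, p.2}) ?_ ?_ ?_ ?_
  · rintro ⟨a, b⟩ h1 ⟨c, d⟩ h2 h3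
    simp at h1 h2 h3
    have h4 : ({a, b} : Finset (Fin n)) = {c, d} := by
      rw [← Finset.sdiff_sdiff_eq_self (s := S) (t := {a, b}), h3, Finset.sdiff_sdiff_eq_self]
      · intro x; simp; rintro (rfl | rfl) <;> tauto
      · intro x; simp; rintro (rfl | rfl) <;> tauto
    have m1 : a ∈ ({c, d} : Finset (Fin n)) := by rw [← h4]; simp
    have m2 : b ∈ ({c, d} : Finset (Fin n)) := by rw [← h4]; simp
    simp at m1 m2 ⊢
    rcases m1 with rfl | rfl <;> rcases m2 with rfl | rfl <;>
      first | exact ⟨rfl, rfl⟩ | (exfalso; have := h1.1; have := h2.1; omega)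
  · rintro ⟨a, b⟩ _; simp
  · intro A hA hA2
    rw [h _ _, mul_zero]
    intro hc
    obtain ⟨a, b, hab, he⟩ := Finset.card_eq_two.mp hc
    have hAS : A ⊆ S := by simpa using hA
    have ha : a ∈ S := by
      have : a ∈ S \ A := by rw [he]; simp
      exact (Finset.mem_sdiff.mp this).1
    have hb : b ∈ S := by
      have : b ∈ S \ A := by rw [he]; simp
      exact (Finset.mem_sdiff.mp this).1
    apply hA2
    have hA' : A = S \ {a, b} := by rw [← he, Finset.sdiff_sdiff_eq_self hAS]
    rcases lt_or_gt_of_ne hab with h1 | h1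
    · exact ⟨(a, b), by simp [h1, ha, hb], hA'.symm⟩
    · exact ⟨(b, a), by simp [h1, ha, hb], by simp only [Finset.pair_comm b a]; exact hA'.symm⟩
  · rintro ⟨a, b⟩ hp
    simp at hp
    obtain ⟨hab, ha, hb⟩ := hp
    have hsub : ({a, b} : Finset (Fin n)) ⊆ S := by
      intro x; simp; rintro (rfl | rfl) <;> assumption
    have hD : S \ {a, b} = (S.erase a).erase b := by ext x; simp; tauto
    simp only
    rw [Finset.sdiff_sdiff_eq_self hsub, shuffle_pair a b S hab hb, hD]

lemma mul_gm (ω : DF n) : mul (gm n) ω = Gop n ω := by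
  funext S T
  have e1 : mul (gm n) ω S T = ∑ A ∈ S.powerset, shuffleSign A (S \ A) *
      (fun A D => ∑ C ∈ T.powerset, shuffleSign C (T \ C) *
        (fun C E => gm n A C * ω D E) C (T \ C)) A (S \ A) := by
    simp only [mul, Finset.mul_sum]
    refine Finset.sum_congr rfl fun A _ => Finset.sum_congr rfl fun C _ => by ring
  rw [e1, sum_card_one S (fun A D => ∑ C ∈ T.powerset, shuffleSign C (T \ C) *
        (fun C E => gm n A C * ω D E) C (T \ C))]
  · simp only [Gop, end_sum_apply, Module.End.mul_apply, cL_apply, cR_apply]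
    refine Finset.sum_congr rfl fun a _ => ?_
    split_ifs with h1 h2
    · rw [sum_card_one T (fun C E => gm n {a} C * ω (S.erase a) E)]
      · rw [Finset.sum_eq_single a]
        · simp [h2, gm]
        · intro b _ hb; simp [gm, hb.symm]
        · simp
      · intro A D hA
        have : gm n {a} A = 0 := by
          simp only [gm]; rw [if_neg]; rintro ⟨rfl, _⟩; simp at hA
        simp [this]
    · rw [sum_card_one T (fun C E => gm n {a} C * ω (S.erase a) E)]
      · rw [Finset.sum_eq_zero, mul_zero]
        intro b _
        by_cases hb : b = a
        · subst hb; simp [h2]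
        · have : gm n {a} {b} = 0 := by simp [gm, Ne.symm hb]
          simp only [this]; simp
      · intro A D hA
        have : gm n {a} A = 0 := by
          simp only [gm]; rw [if_neg]; rintro ⟨rfl, _⟩; simp at hA
        simp [this]
    · rfl
  · intro A D hA
    refine Finset.sum_eq_zero fun C _ => ?_
    simp [gm, hA]

lemma shuffle_empty_left (S : Finset (Fin n)) : shuffleSign ∅ S = 1 := by simp [shuffleSign]
lemma shuffle_empty_right (S : Finset (Fin n)) : shuffleSign S ∅ = 1 := by simp [shuffleSign]

lemma one_mul' (ω : DF n) : mul (one n) ω = ω := by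
  funext S T
  simp only [mul]
  rw [Finset.sum_eq_single ∅]
  · rw [Finset.sum_eq_single ∅]
    · simp [one, shuffle_empty_left]
    · intro C _ hC; simp [one, hC]
    · simp
  · intro C _ hC; simp [one, hC]
  · simp

lemma mul_one' (ω : DF n) : mul ω (one n) = ω := by
  funext S T
  simp only [mul]
  rw [Finset.sum_eq_single S]
  · rw [Finset.sum_eq_single T]
    · simp [one, shuffle_empty_right]
    · intro C hC hC2
      have : T \ C ≠ ∅ := by
        intro h; apply hC2; simp at hC
        exact Finset.Subset.antisymm hC (Finset.sdiff_eq_empty_iff_subset.mp h)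
      simp [one, this]
    · simp
  · intro C hC hC2
    have : S \ C ≠ ∅ := by
      intro h; apply hC2; simp at hC
      exact Finset.Subset.antisymm hC (Finset.sdiff_eq_empty_iff_subset.mp h)
    simp [one, this]
  · simp

lemma mul_smul' (r : ℝ) (ω θ : DF n) : mul ω (r • θ) = r • mul ω θ := by
  funext S T
  simp only [mul, Pi.smul_apply, smul_eq_mul, Finset.mul_sum]
  refine Finset.sum_congr rfl fun A _ => Finset.sum_congr rfl fun C _ => by ring

noncomputable def Mop (q : Fin n → Fin n → Fin n → Fin n → ℝ) : Module.End ℝ (DF n) :=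
  ∑ a, ∑ b, ∑ c, ∑ d, if a < b ∧ c < d then q a b c d • (cL a * cL b * (cR c * cR d)) else 0

lemma mul_deg_two (ω θ : DF n) (h : IsDeg 2 θ) :
    mul ω θ = Mop (fun a b c d => θ {a, b} {c, d}) ω := by
  funext S T
  have e1 : mul ω θ S T = ∑ A ∈ S.powerset, shuffleSign A (S \ A) *
      (fun A D => ∑ C ∈ T.powerset, shuffleSign C (T \ C) *
        (fun C E => ω A C * θ D E) C (T \ C)) A (S \ A) := by
    simp only [mul, Finset.mul_sum]
    refine Finset.sum_congr rfl fun A _ => Finset.sum_congr rfl fun C _ => by ring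
  have h1 : ∀ D E, D.card ≠ 2 → θ D E = 0 := fun D E hD => by
    by_contra h0; exact hD (h D E h0).1
  have h2 : ∀ D E, E.card ≠ 2 → θ D E = 0 := fun D E hD => by
    by_contra h0; exact hD (h D E h0).2
  rw [e1, sum_card_two S (fun A D => ∑ C ∈ T.powerset, shuffleSign C (T \ C) *
        (fun C E => ω A C * θ D E) C (T \ C))]
  · simp only [Mop, end_sum_apply]
    refine Finset.sum_congr rfl fun a _ => Finset.sum_congr rfl fun b _ => ?_
    rw [sum_card_two T (fun C E => ω ((S.erase a).erase b) C * θ {a, b} E) (by intro A D hD; simp [h2 _ _ hD])]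
    rw [← ite_zero_mul]
    rw [Finset.mul_sum]
    refine Finset.sum_congr rfl fun c _ => ?_
    rw [Finset.mul_sum]
    refine Finset.sum_congr rfl fun d _ => ?_
    by_cases hab : a < b <;> by_cases hcd : c < d <;> simp only [hab, hcd, true_and, false_and,
      and_true, and_false, if_true, if_false, mul_zero, zero_mul, ite_self,
      LinearMap.zero_apply, Pi.zero_apply]
    simp only [LinearMap.smul_apply, Pi.smul_apply, Module.End.mul_apply, cL_apply, cR_apply,
      Finset.mem_erase, hab.ne', hcd.ne', ne_eq, not_false_eq_true, true_and, smul_eq_mul]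
    by_cases i1 : a ∈ S <;> by_cases i2 : b ∈ S <;> by_cases i3 : c ∈ T <;> by_cases i4 : d ∈ T <;>
      simp [i1, i2, i3, i4]
    ring
  · intro A D hD
    refine Finset.sum_eq_zero fun C _ => ?_
    simp [h1 _ _ hD]

lemma B_M (r : Fin n → Fin n → Fin n → Fin n → ℝ)
    (hab : ∀ a b c d, r a b c d = - r b a c d)
    (hcd : ∀ a b c d, r a b c d = - r a b d c)
    (hb : ∀ a b c d, r a b c d + r b c a d + r c a b d = 0) :
    Bop n * Mop r = Mop r * Bop n := car_all.B_M r hab hcd hb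

lemma B_one : Bop n (one n) = 0 := by
  funext S T
  simp only [Bop, end_sum_apply]
  refine Finset.sum_eq_zero fun i _ => ?_
  simp [Module.End.mul_apply, cL_apply, aR_apply, one]

/-! ### Degree and symmetry -/

lemma deg_one : IsDeg 0 (one n) := by
  intro S T h
  simp only [one, ne_eq, ite_eq_right_iff, Classical.not_imp] at h
  simp [h.1.1, h.1.2]

lemma deg_gm : IsDeg 1 (gm n) := by
  intro S T h
  simp only [gm, ne_eq, ite_eq_right_iff, Classical.not_imp] at h
  exact ⟨h.1.2, h.1.1 ▸ h.1.2⟩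

lemma deg_mul {p q : ℕ} {ω θ : DF n} (h1 : IsDeg p ω) (h2 : IsDeg q θ) :
    IsDeg (p + q) (mul ω θ) := by
  intro S T h
  obtain ⟨A, hA, h⟩ := Finset.exists_ne_zero_of_sum_ne_zero h
  obtain ⟨C, hC, h⟩ := Finset.exists_ne_zero_of_sum_ne_zero h
  have hω : ω A C ≠ 0 := by intro h0; simp [h0] at h
  have hθ : θ (S \ A) (T \ C) ≠ 0 := by intro h0; simp [h0] at h
  have a1 := h1 _ _ hω
  have a2 := h2 _ _ hθ
  rw [Finset.mem_powerset] at hA hC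
  have b1 := Finset.card_sdiff_add_card_eq_card hA
  have b2 := Finset.card_sdiff_add_card_eq_card hC
  omega

lemma deg_contr {p : ℕ} {ω : DF n} (h1 : IsDeg (p + 1) ω) : IsDeg p (contr ω) := by
  intro S T h
  obtain ⟨i, _, h⟩ := Finset.exists_ne_zero_of_sum_ne_zero h
  by_cases hi : i ∈ S ∨ i ∈ T
  · simp [hi] at h
  · rw [if_neg hi] at h
    have h2 := h1 _ _ (right_ne_zero_of_mul h)
    push Not at hi
    rw [Finset.card_insert_of_notMem hi.1, Finset.card_insert_of_notMem hi.2] at h2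
    omega

lemma deg_contrN {p r : ℕ} {ω : DF n} (h1 : IsDeg (p + r) ω) : IsDeg p (contrN r ω) := by
  induction r generalizing ω with
  | zero => exact h1
  | succ r ih => exact ih (deg_contr h1)

lemma deg_pow {p : ℕ} {ω : DF n} (h1 : IsDeg p ω) (k : ℕ) : IsDeg (k * p) (pow ω k) := by
  induction k with
  | zero => rw [zero_mul]; exact deg_one
  | succ k ih => rw [Nat.succ_mul]; exact deg_mul ih h1

lemma deg_smul {p : ℕ} {ω : DF n} (r : ℝ) (h1 : IsDeg p ω) : IsDeg p (r • ω) := by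
  intro S T h
  exact h1 S T (right_ne_zero_of_mul h)

lemma deg_add {p : ℕ} {ω θ : DF n} (h1 : IsDeg p ω) (h2 : IsDeg p θ) : IsDeg p (ω + θ) := by
  intro S T h
  by_cases h0 : ω S T = 0
  · exact h2 S T (by simpa [h0] using h)
  · exact h1 S T h0

lemma deg_sub {p : ℕ} {ω θ : DF n} (h1 : IsDeg p ω) (h2 : IsDeg p θ) : IsDeg p (ω - θ) := by
  intro S T h
  by_cases h0 : ω S T = 0
  · exact h2 S T (by simpa [h0] using h)
  · exact h1 S T h0

lemma symm_one : IsSymm (one n) := by intro S T; simp [one, and_comm]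

lemma symm_gm : IsSymm (gm n) := by
  intro S T
  simp only [gm]
  by_cases h : S = T
  · subst h; rfl
  · simp [h, Ne.symm h]

lemma symm_mul {ω θ : DF n} (h1 : IsSymm ω) (h2 : IsSymm θ) : IsSymm (mul ω θ) := by
  intro S T
  simp only [mul]
  rw [Finset.sum_comm]
  refine Finset.sum_congr rfl fun A _ => Finset.sum_congr rfl fun C _ => ?_
  rw [h1 C A, h2 (S \ C) (T \ A)]; ring

lemma symm_contr {ω : DF n} (h1 : IsSymm ω) : IsSymm (contr ω) := by
  intro S T
  simp only [contr]
  refine Finset.sum_congr rfl fun i _ => ?_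
  rw [h1, mul_comm (shuffleSign {i} S)]
  simp only [or_comm]

lemma symm_contrN {ω : DF n} (r : ℕ) (h1 : IsSymm ω) : IsSymm (contrN r ω) := by
  induction r generalizing ω with
  | zero => exact h1
  | succ r ih => exact ih (symm_contr h1)

lemma symm_pow {ω : DF n} (k : ℕ) (h1 : IsSymm ω) : IsSymm (pow ω k) := by
  induction k with
  | zero => exact symm_one
  | succ k ih => exact symm_mul ih h1

lemma symm_smul {ω : DF n} (r : ℝ) (h1 : IsSymm ω) : IsSymm (r • ω) := by
  intro S T; simp only [Pi.smul_apply]; rw [h1]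

lemma symm_add {ω θ : DF n} (h1 : IsSymm ω) (h2 : IsSymm θ) : IsSymm (ω + θ) := by
  intro S T; simp only [Pi.add_apply]; rw [h1, h2]

lemma symm_sub {ω θ : DF n} (h1 : IsSymm ω) (h2 : IsSymm θ) : IsSymm (ω - θ) := by
  intro S T; simp only [Pi.sub_apply]; rw [h1, h2]

lemma contrN_succ (r : ℕ) (ω : DF n) : contrN (r + 1) ω = Cop n (contrN r ω) := by
  rw [← contr_eq]; exact Function.iterate_succ_apply' _ _ _

lemma B_contrN (r : ℕ) (ω : DF n) (h : Bop n ω = 0) : Bop n (contrN r ω) = 0 := by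
  induction r with
  | zero => exact h
  | succ r ih =>
    rw [contrN_succ, ← Module.End.mul_apply, B_C, Module.End.mul_apply, ih, map_zero]

lemma B_gm_mul (ω : DF n) (h : Bop n ω = 0) : Bop n (Gop n ω) = 0 := by
  rw [← Module.End.mul_apply, B_G, Module.End.mul_apply, h, map_zero]

lemma gm_eq : gm n = Gop n (one n) := by rw [← mul_gm, mul_one']

lemma pow_gm_two : pow (gm n) 2 = Gop n (Gop n (one n)) := by
  change mul (mul (one n) (gm n)) (gm n) = _
  rw [one_mul', mul_gm, ← gm_eq]

lemma deg_zero_eq (ω : DF n) (h : IsDeg 0 ω) : ω = toScalar ω • one n := by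
  funext S T
  by_cases h1 : S = ∅ ∧ T = ∅
  · obtain ⟨rfl, rfl⟩ := h1; simp [one, toScalar]
  · simp only [Pi.smul_apply, one, h1, if_false, smul_zero]
    by_contra h0
    have := h S T h0
    simp at this; exact h1 this

lemma Cop_one : Cop n (one n) = 0 := by
  rw [← contr_eq]
  funext S T
  simp [contr, one]

lemma Cop_gm : Cop n (gm n) = (n : ℝ) • one n := by
  rw [gm_eq, C_G_deg 0 _ deg_one, Cop_one]; simp

end DFOp

section Curv

variable {n : ℕ} {V : Type*} [NormedAddCommGroup V] [InnerProductSpace ℝ V]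

lemma ofCurv_deg (e : OrthonormalBasis (Fin n) ℝ V) (R : V → V → V → V → ℝ) :
    DF.IsDeg 2 (ofCurv e R) := by
  intro S T h
  by_contra h0
  exact h (by simp [ofCurv, ofForm, h0])

lemma pair_orderIso (a b : Fin n) (hab : a < b) (h : ({a, b} : Finset (Fin n)).card = 2) :
    ((({a, b} : Finset (Fin n)).orderIsoOfFin h 0 : Fin n) = a) ∧
    ((({a, b} : Finset (Fin n)).orderIsoOfFin h 1 : Fin n) = b) := by
  have hu := Finset.orderEmbOfFin_unique h (f := ![a, b])
    (by intro x; fin_cases x <;> simp)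
    (by intro x y hxy; fin_cases x <;> fin_cases y <;> simp_all)
  constructor
  · have := congrFun hu 0; simpa using this.symm
  · have := congrFun hu 1; simpa using this.symm

lemma ofCurv_apply (e : OrthonormalBasis (Fin n) ℝ V) (R : V → V → V → V → ℝ)
    (a b c d : Fin n) (hab : a < b) (hcd : c < d) :
    ofCurv e R {a, b} {c, d} = R (e a) (e b) (e c) (e d) := by
  have h1 : ({a, b} : Finset (Fin n)).card = 2 := Finset.card_pair hab.ne
  have h2 : ({c, d} : Finset (Fin n)).card = 2 := Finset.card_pair hcd.ne
  simp only [ofCurv, ofForm, h1, h2, and_self, dif_pos]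
  rw [(pair_orderIso a b hab h1).1, (pair_orderIso a b hab h1).2,
    (pair_orderIso c d hcd h2).1, (pair_orderIso c d hcd h2).2]

lemma ofCurv_symm (e : OrthonormalBasis (Fin n) ℝ V) (R : V → V → V → V → ℝ) (hR : IsCurv R) :
    DF.IsSymm (ofCurv e R) := by
  intro S T
  by_cases h : S.card = 2 ∧ T.card = 2
  · simp only [ofCurv, ofForm, h, and_self, dif_pos]
    rw [hR.pair_symm]
  · have h' : ¬ (T.card = 2 ∧ S.card = 2) := fun h2 => h h2.symm
    simp [ofCurv, ofForm, h, h']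

lemma B_pow_curv (e : OrthonormalBasis (Fin n) ℝ V) (R : V → V → V → V → ℝ) (hR : IsCurv R)
    (k : ℕ) : DFOp.Bop n (DF.pow (ofCurv e R) k) = 0 := by
  induction k with
  | zero => exact DFOp.B_one
  | succ k ih =>
    change DFOp.Bop n (DF.mul (DF.pow (ofCurv e R) k) (ofCurv e R)) = 0
    rw [DFOp.mul_deg_two _ _ (ofCurv_deg e R)]
    have hM : DFOp.Mop (fun a b c d => ofCurv e R {a, b} {c, d}) =
        DFOp.Mop (fun a b c d => R (e a) (e b) (e c) (e d)) := by
      unfold DFOp.Mop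
      refine Finset.sum_congr rfl fun a _ => Finset.sum_congr rfl fun b _ =>
        Finset.sum_congr rfl fun c _ => Finset.sum_congr rfl fun d _ => ?_
      split_ifs with hh
      · simp only [ofCurv_apply e R a b c d hh.1 hh.2]
      · rfl
    rw [hM, ← Module.End.mul_apply, DFOp.B_M, Module.End.mul_apply, ih, map_zero]
    · intro a b c d; exact hR.antisymm _ _ _ _
    · intro a b c d
      rw [hR.pair_symm, hR.antisymm, hR.pair_symm (e d)]
    · intro a b c d; exact hR.bianchi _ _ _ _

end Curv

/-- For an algebraic curvature tensor `R` and `k ≥ 1` with `2k ≤ n−2`,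
the Newton transformation `N_k(R)` is a symmetric `(2,2)`-double form satisfying the
first Bianchi identity, and `c N_k(R) = (n−2k−1)·T_{2k}`,
`c² N_k(R) = (n−2k)(n−2k−1)·h_{2k}`. -/
theorem stmt7_newton_transform_of_curvature
    (n k : ℕ) (hk : 1 ≤ k) (hkn : 2 * k ≤ n - 2)
    (V : Type*) [NormedAddCommGroup V] [InnerProductSpace ℝ V]
    (hV : Module.finrank ℝ V = n)
    (e : OrthonormalBasis (Fin n) ℝ V)
    (R : V → V → V → V → ℝ) (hR : IsCurv R) :
    DF.IsDeg 2 (newtonCurv k (ofCurv e R)) ∧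
    DF.IsSymm (newtonCurv k (ofCurv e R)) ∧
    DF.FirstBianchi 2 (newtonCurv k (ofCurv e R)) ∧
    DF.contrN 1 (newtonCurv k (ofCurv e R)) =
      ((n : ℝ) - 2 * (k : ℝ) - 1) • lovelock k (ofCurv e R) ∧
    DF.toScalar (DF.contrN 2 (newtonCurv k (ofCurv e R))) =
      ((n : ℝ) - 2 * (k : ℝ)) * ((n : ℝ) - 2 * (k : ℝ) - 1) * h2kDF k (ofCurv e R) := by
  obtain ⟨m, rfl⟩ : ∃ m, k = m + 1 := ⟨k - 1, by omega⟩
  clear hkn hV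
  set Rd := ofCurv e R with hRd
  have i0 : 2 * (m + 1) - 2 = 2 * m := by omega
  have i1 : 2 * (m + 1) - 1 = 2 * m + 1 := by omega
  have i2 : 2 * (m + 1) = 2 * m + 2 := by omega
  have hdeg : DF.IsDeg (2 * m + 2) (DF.pow Rd (m + 1)) := by
    have := DFOp.deg_pow (ofCurv_deg e R) (m + 1)
    rwa [show (m + 1) * 2 = 2 * m + 2 by ring] at this
  have hsym := DFOp.symm_pow (m + 1) (ofCurv_symm e R hR)
  have hB := B_pow_curv e R hR (m + 1)
  rw [← hRd] at hsym hB
  have hN : newtonCurv (m + 1) Rd =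
      ((2 * m).factorial : ℝ)⁻¹ • DF.contrN (2 * m) (DF.pow Rd (m + 1))
      - ((2 * m + 1).factorial : ℝ)⁻¹ •
          DFOp.Gop n (DF.contrN (2 * m + 1) (DF.pow Rd (m + 1)))
      + (h2kDF (m + 1) Rd / 2) • DFOp.Gop n (DF.gm n) := by
    have d0 : DF.IsDeg 0 (DF.contrN (2 * m + 2) (DF.pow Rd (m + 1))) :=
      DFOp.deg_contrN (by simpa using hdeg)
    unfold newtonCurv h2kDF
    rw [i0, i1, i2]
    rw [DFOp.mul_smul', DFOp.mul_gm]
    congr 1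
    nth_rewrite 1 [DFOp.deg_zero_eq _ d0]
    rw [DFOp.mul_smul', DFOp.mul_one', DFOp.pow_gm_two, ← DFOp.gm_eq, smul_smul]
    congr 1
    field_simp
  have hL : lovelock (m + 1) Rd = h2kDF (m + 1) Rd • DF.gm n -
      ((2 * m + 1).factorial : ℝ)⁻¹ • DF.contrN (2 * m + 1) (DF.pow Rd (m + 1)) := by
    unfold lovelock; rw [i1]
  have d2 : DF.IsDeg 2 (DF.contrN (2 * m) (DF.pow Rd (m + 1))) :=
    DFOp.deg_contrN (by rwa [add_comm])
  have d1 : DF.IsDeg 1 (DF.contrN (2 * m + 1) (DF.pow Rd (m + 1))) :=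
    DFOp.deg_contrN (by rwa [show 1 + (2 * m + 1) = 2 * m + 2 by ring])
  have d0 : DF.IsDeg 0 (DF.contrN (2 * m + 2) (DF.pow Rd (m + 1))) :=
    DFOp.deg_contrN (by simpa using hdeg)
  have x2 : DF.contrN (2 * m + 2) (DF.pow Rd (m + 1)) =
      (h2kDF (m + 1) Rd * ((2 * m + 2).factorial : ℝ)) • DF.one n := by
    rw [DFOp.deg_zero_eq _ d0]
    congr 1
    unfold h2kDF
    rw [i2]
    field_simp
  have f0 : ((2 * m).factorial : ℝ) ≠ 0 := by positivity
  have f1 : ((2 * m + 1).factorial : ℝ) = (2 * m + 1) * ((2 * m).factorial : ℝ) := by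
    rw [Nat.factorial_succ]; push_cast; ring
  have f2 : ((2 * m + 2).factorial : ℝ) = (2 * m + 2) * ((2 * m + 1) * ((2 * m).factorial : ℝ)) := by
    rw [Nat.factorial_succ, Nat.cast_mul, f1]; push_cast; ring
  have hm1 : (2 * (m : ℝ) + 1) ≠ 0 := by positivity
  have hC : DFOp.Cop n (newtonCurv (m + 1) Rd) =
      ((n : ℝ) - 2 * ((m + 1 : ℕ) : ℝ) - 1) • lovelock (m + 1) Rd := by
    rw [hN, hL]
    simp only [map_add, map_sub, map_smul]
    rw [DFOp.C_G_deg 1 _ d1, DFOp.C_G_deg 1 _ DFOp.deg_gm, DFOp.Cop_gm,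
      ← DFOp.contrN_succ, ← DFOp.contrN_succ, x2]
    simp only [map_smul, ← DFOp.gm_eq]
    funext S T
    simp only [Pi.add_apply, Pi.sub_apply, Pi.smul_apply, smul_eq_mul]
    rw [f1, f2]
    generalize DF.contrN (2 * m + 1) (DF.pow Rd (m + 1)) S T = x
    push_cast
    field_simp
    ring
  refine ⟨?_, ?_, ?_, ?_, ?_⟩
  · rw [hN, ← DFOp.mul_gm, ← DFOp.mul_gm]
    exact DFOp.deg_add (DFOp.deg_sub (DFOp.deg_smul _ d2)
      (DFOp.deg_smul _ (DFOp.deg_mul DFOp.deg_gm d1)))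
      (DFOp.deg_smul _ (DFOp.deg_mul DFOp.deg_gm DFOp.deg_gm))
  · rw [hN, ← DFOp.mul_gm, ← DFOp.mul_gm]
    exact DFOp.symm_add (DFOp.symm_sub (DFOp.symm_smul _ (DFOp.symm_contrN _ hsym))
      (DFOp.symm_smul _ (DFOp.symm_mul DFOp.symm_gm (DFOp.symm_contrN _ hsym))))
      (DFOp.symm_smul _ (DFOp.symm_mul DFOp.symm_gm DFOp.symm_gm))
  · apply DFOp.bianchi_of
    rw [hN, map_add, map_sub, map_smul, map_smul, map_smul, DFOp.B_contrN _ _ hB,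
      DFOp.B_gm_mul _ (DFOp.B_contrN _ _ hB), DFOp.gm_eq,
      DFOp.B_gm_mul _ (DFOp.B_gm_mul _ DFOp.B_one)]
    simp
  · rw [DFOp.contrN_succ]; exact hC
  · rw [DFOp.contrN_succ, DFOp.contrN_succ]
    change DF.toScalar (DFOp.Cop n (DFOp.Cop n (newtonCurv (m + 1) Rd))) = _
    rw [hC, hL]
    simp only [map_sub, map_smul]
    rw [DFOp.Cop_gm, ← DFOp.contrN_succ, x2]
    simp only [DF.toScalar, Pi.sub_apply, Pi.smul_apply, smul_eq_mul, DF.one, and_self, if_true]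
    rw [f1, f2]
    push_cast
    field_simp
end

section
/- σ₂ is the non-Weyl part of h₄: let R be an algebraic curvature tensor on an n-dimensional real inner product space (V,g) with n ≥ 4, let A = (1/(n−2))·(cR − (c²R/(2(n−1)))·g) be its Schouten tensor and W = R − gA its Weyl tensor. Then h₄ = |W|² + 2(n−2)(n−3)·σ₂(A). In particular, σ₂(A) > 0 implies h₄ > 0, and σ₂(A) ≥ 0 implies h₄ ≥ 0. -/
/-!
Double forms on an `n`-dimensional real inner product space `(V, g)`, represented
by their components with respect to a (fixed) orthonormal basis: a `(p,q)`-double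
form is determined by its values on pairs of increasingly ordered tuples of
distinct basis vectors, i.e. by a function `Finset (Fin n) → Finset (Fin n) → ℝ`
(supported on pairs of sets of cardinalities `p` and `q`).
-/

open Finset

namespace S12
open DF

variable {n : ℕ}

def ep (i j : Fin n) : ℝ := if j < i then -1 else 1

lemma ep_sq (i j : Fin n) : ep i j * ep i j = 1 := by unfold ep; split_ifs <;> norm_num

lemma ep_swap {i j : Fin n} (h : i ≠ j) : ep j i = - ep i j := by
  unfold ep
  rcases lt_or_gt_of_ne h with h | h
  · rw [if_pos h, if_neg (not_lt.mpr h.le)]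
  · rw [if_pos h, if_neg (not_lt.mpr h.le)]; norm_num

lemma ss_single (i : Fin n) (S : Finset (Fin n)) : shuffleSign {i} S = ∏ j ∈ S, ep i j := by
  unfold shuffleSign ep
  rw [Finset.sum_singleton, Finset.prod_ite]; simp

lemma ss_insert {i : Fin n} {A : Finset (Fin n)} (h : i ∉ A) (S : Finset (Fin n)) :
    shuffleSign (insert i A) S = shuffleSign {i} S * shuffleSign A S := by
  unfold shuffleSign
  rw [Finset.sum_insert h, pow_add, Finset.sum_singleton]

lemma ss_empty (S : Finset (Fin n)) : shuffleSign ∅ S = 1 := by simp [shuffleSign]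

lemma ss_sq (A S : Finset (Fin n)) : shuffleSign A S * shuffleSign A S = 1 := by
  unfold shuffleSign; rw [← mul_pow]; simp

lemma ss_pair {a b c d : Fin n} (hab : a ≠ b) (hcd : c ≠ d) :
    shuffleSign {a, b} {c, d} = ep a c * ep a d * ep b c * ep b d := by
  rw [ss_insert (by simpa using hab), ss_single, ss_single, Finset.prod_pair hcd,
    Finset.prod_pair hcd]; ring

lemma contr_diag (θ : DF n) (S : Finset (Fin n)) :
    contr θ S S = ∑ i, if i ∈ S then 0 else θ (insert i S) (insert i S) := by
  unfold contr
  refine Finset.sum_congr rfl fun i _ => ?_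
  simp only [or_self, ss_sq, one_mul]

lemma one_mul' (ω : DF n) : mul (one n) ω = ω := by
  funext S T
  unfold mul one
  rw [Finset.sum_eq_single ∅, Finset.sum_eq_single ∅]
  · simp [ss_empty]
  · intro C _ hC; simp [hC]
  · simp
  · intro A _ hA; simp [hA]
  · simp

lemma six_sum {a b c d : Fin n} (hab : a ≠ b) (hac : a ≠ c) (had : a ≠ d) (hbc : b ≠ c)
    (hbd : b ≠ d) (hcd : c ≠ d) (f : Finset (Fin n) → Finset (Fin n) → ℝ)
    (hf : ∀ A B, A.card ≠ 2 → f A B = 0) :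
    ∑ A ∈ ({a, b, c, d} : Finset (Fin n)).powerset, f A ({a, b, c, d} \ A) =
      f {a, b} {c, d} + f {a, c} {b, d} + f {a, d} {b, c} + f {b, c} {a, d}
        + f {b, d} {a, c} + f {c, d} {a, b} := by
  have P2 : ∀ F : Finset (Fin n) → ℝ, ∑ A ∈ ({c, d} : Finset (Fin n)).powerset, F A =
      F ∅ + F {d} + (F {c} + F {c, d}) := by
    intro F
    have P1 : ∀ F : Finset (Fin n) → ℝ, ∑ A ∈ ({d} : Finset (Fin n)).powerset, F A =
        F ∅ + F {d} := by
      intro F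
      rw [← insert_empty_eq d, Finset.sum_powerset_insert (by simp)]
      simp
    rw [Finset.sum_powerset_insert (by simp [*]), P1, P1]; simp
  rw [Finset.sum_powerset_insert (by simp [*]), Finset.sum_powerset_insert (a := b) (by simp [*])]
  rw [Finset.sum_powerset_insert (a := b) (by simp [*])]
  simp only [P2]
  simp only [insert_empty_eq]
  have h0 : ∀ B, f ∅ B = 0 := fun B => hf _ _ (by simp)
  have h1 : ∀ x B, f {x} B = 0 := fun x B => hf _ _ (by simp)
  have h3 : ∀ x y z B, x ≠ y → x ≠ z → y ≠ z → f {x, y, z} B = 0 := fun x y z B h1 h2 h3 =>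
    hf _ _ (by rw [Finset.card_eq_three.mpr ⟨x, y, z, h1, h2, h3, rfl⟩]; norm_num)
  have h4 : ∀ B, f {a, b, c, d} B = 0 := fun B =>
    hf _ _ (by rw [Finset.card_insert_of_notMem (by simp [*]),
      Finset.card_eq_three.mpr ⟨b, c, d, hbc, hbd, hcd, rfl⟩]; norm_num)
  rw [h3 _ _ _ _ hab hac hbc, h3 _ _ _ _ hab had hbd, h3 _ _ _ _ hac had hcd,
    h3 _ _ _ _ hbc hbd hcd]
  simp only [h0, h1, h4]
  have e1 : ({a, b, c, d} : Finset (Fin n)) \ {a, b} = {c, d} := by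
    ext x; simp only [mem_sdiff, mem_insert, mem_singleton]; grind
  have e2 : ({a, b, c, d} : Finset (Fin n)) \ {a, c} = {b, d} := by
    ext x; simp only [mem_sdiff, mem_insert, mem_singleton]; grind
  have e3 : ({a, b, c, d} : Finset (Fin n)) \ {a, d} = {b, c} := by
    ext x; simp only [mem_sdiff, mem_insert, mem_singleton]; grind
  have e4 : ({a, b, c, d} : Finset (Fin n)) \ {b, c} = {a, d} := by
    ext x; simp only [mem_sdiff, mem_insert, mem_singleton]; grind
  have e5 : ({a, b, c, d} : Finset (Fin n)) \ {b, d} = {a, c} := by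
    ext x; simp only [mem_sdiff, mem_insert, mem_singleton]; grind
  have e6 : ({a, b, c, d} : Finset (Fin n)) \ {c, d} = {a, b} := by
    ext x; simp only [mem_sdiff, mem_insert, mem_singleton]; grind
  rw [e1, e2, e3, e4, e5, e6]; ring

lemma two_sum {a b : Fin n} (hab : a ≠ b) (f : Finset (Fin n) → Finset (Fin n) → ℝ)
    (hf : ∀ A B, A.card ≠ 1 → f A B = 0) :
    ∑ A ∈ ({a, b} : Finset (Fin n)).powerset, f A ({a, b} \ A) = f {a} {b} + f {b} {a} := by
  rw [Finset.sum_powerset_insert (by simp [*]), ← insert_empty_eq b,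
    Finset.sum_powerset_insert (by simp [*]), Finset.sum_powerset_insert (by simp [*])]
  simp only [Finset.powerset_empty, Finset.sum_singleton, insert_empty_eq]
  have e1 : ({a, b} : Finset (Fin n)) \ {a} = {b} := by
    ext x; simp only [mem_sdiff, mem_insert, mem_singleton]; grind
  have e2 : ({a, b} : Finset (Fin n)) \ {b} = {a} := by
    ext x; simp only [mem_sdiff, mem_insert, mem_singleton]; grind
  rw [hf ∅ _ (by simp), hf {a, b} _ (by simp [Finset.card_pair hab]), e1, e2]; ring

lemma pair_sum (F : Finset (Fin n) → ℝ) (hF : ∀ S, S.card ≠ 2 → F S = 0) :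
    ∑ i, ∑ j, (if i = j then 0 else F {i, j}) = 2 * ∑ S, F S := by
  classical
  rw [← Finset.sum_product', Finset.univ_product_univ]
  rw [← Finset.sum_fiberwise (s := Finset.univ) (g := fun p : Fin n × Fin n => ({p.1, p.2} : Finset (Fin n)))]
  rw [Finset.mul_sum]
  refine Finset.sum_congr rfl fun S _ => ?_
  by_cases hS : S.card = 2
  · obtain ⟨x, y, hxy, rfl⟩ := Finset.card_eq_two.mp hS
    have : (Finset.univ.filter fun p : Fin n × Fin n => ({p.1, p.2} : Finset (Fin n)) = {x, y})
        = {(x, y), (y, x)} := by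
      ext ⟨p, q⟩
      simp only [mem_filter, mem_univ, true_and, mem_insert, mem_singleton, Prod.mk.injEq]
      constructor
      · intro h
        have h1 : p ∈ ({x, y} : Finset (Fin n)) := h ▸ (by simp)
        have h2 : q ∈ ({x, y} : Finset (Fin n)) := h ▸ (by simp)
        have h3 : x ∈ ({p, q} : Finset (Fin n)) := h ▸ (by simp)
        have h4 : y ∈ ({p, q} : Finset (Fin n)) := h ▸ (by simp)
        simp only [mem_insert, mem_singleton] at h1 h2 h3 h4
        grind
      · rintro (⟨rfl, rfl⟩ | ⟨rfl, rfl⟩)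
        · rfl
        · exact Finset.pair_comm _ _
    rw [this, Finset.sum_pair (by simp [hxy])]
    simp only [if_neg hxy, if_neg hxy.symm, Finset.pair_comm y x]; ring
  · rw [hF S hS, mul_zero]
    refine Finset.sum_eq_zero fun p hp => ?_
    have := (Finset.mem_filter.mp hp).2
    split_ifs
    · rfl
    · rw [this, hF S hS]

/-- Component description of a `(2,2)` double form. -/
structure Rep (ω : DF n) (r : Fin n → Fin n → Fin n → Fin n → ℝ) : Prop where
  supp : ∀ S T, ¬ (S.card = 2 ∧ T.card = 2) → ω S T = 0
  val : ∀ i j k l, i ≠ j → k ≠ l → ω {i, j} {k, l} = ep i j * ep k l * r i j k l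
  anti : ∀ i j k l, r j i k l = - r i j k l
  anti2 : ∀ i j k l, r i j l k = - r i j k l

lemma Rep.z1 {ω : DF n} {r} (h : Rep ω r) (i k l) : r i i k l = 0 := by
  have := h.anti i i k l; linarith

lemma Rep.z2 {ω : DF n} {r} (h : Rep ω r) (i k l) : r k l i i = 0 := by
  have := h.anti2 k l i i; linarith

lemma orderIso_pair {i j : Fin n} (hij : i < j) (h : ({i, j} : Finset (Fin n)).card = 2) :
    ((({i, j} : Finset (Fin n)).orderIsoOfFin h 0 : Fin n) = i) ∧
    ((({i, j} : Finset (Fin n)).orderIsoOfFin h 1 : Fin n) = j) := by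
  have hm : StrictMono ![i, j] := by
    intro a b hab
    fin_cases a <;> fin_cases b <;> simp_all
  have := Finset.orderEmbOfFin_unique h (f := ![i, j])
    (by intro x; fin_cases x <;> simp) hm
  have h0 := congrFun this 0
  have h1 := congrFun this 1
  simp only [Finset.coe_orderIsoOfFin_apply]
  exact ⟨h0.symm, h1.symm⟩

lemma rep_curv {V : Type*} [NormedAddCommGroup V] [InnerProductSpace ℝ V]
    (e : OrthonormalBasis (Fin n) ℝ V) (R : V → V → V → V → ℝ) (hR : IsCurv R) :
    Rep (ofCurv e R) (fun i j k l => R (e i) (e j) (e k) (e l)) := by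
  have A1 : ∀ i j k l, R (e j) (e i) (e k) (e l) = - R (e i) (e j) (e k) (e l) :=
    fun i j k l => hR.antisymm _ _ _ _
  have A2 : ∀ i j k l, R (e i) (e j) (e l) (e k) = - R (e i) (e j) (e k) (e l) := by
    intro i j k l
    rw [hR.pair_symm, hR.antisymm, hR.pair_symm]
  have B : ∀ i j k l, i < j → k < l →
      ofCurv e R {i, j} {k, l} = R (e i) (e j) (e k) (e l) := by
    intro i j k l hij hkl
    unfold ofCurv ofForm
    have c1 := Finset.card_pair hij.ne
    have c2 := Finset.card_pair hkl.ne
    rw [dif_pos ⟨c1, c2⟩]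
    dsimp only
    rw [(orderIso_pair hij c1).1, (orderIso_pair hij c1).2, (orderIso_pair hkl c2).1,
      (orderIso_pair hkl c2).2]
  refine ⟨?_, ?_, A1, A2⟩
  · intro S T h
    unfold ofCurv ofForm
    rw [dif_neg h]
  · intro i j k l hij hkl
    rcases lt_or_gt_of_ne hij with h | h <;> rcases lt_or_gt_of_ne hkl with h' | h'
    · rw [B _ _ _ _ h h']; simp [ep, h.not_gt, h'.not_gt]
    · rw [Finset.pair_comm k l, B _ _ _ _ h h', A2]; simp [ep, h.not_gt, h']
    · rw [Finset.pair_comm i j, B _ _ _ _ h h', A1]; simp [ep, h, h'.not_gt]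
    · rw [Finset.pair_comm i j, Finset.pair_comm k l, B _ _ _ _ h h', A1, A2]; simp [ep, h, h']

/-- `(1,1)` forms. -/
lemma Rep.contr1 {ω : DF n} {r} (h : Rep ω r) (j l : Fin n) :
    contr ω {j} {l} = ∑ i, r i j i l := by
  unfold contr
  refine Finset.sum_congr rfl fun i _ => ?_
  simp only [mem_singleton]
  by_cases h1 : i = j
  · subst h1; simp [h.z1]
  by_cases h2 : i = l
  · subst h2; simp [h.z2]
  rw [if_neg (by tauto), h.val i j i l h1 h2, ss_single, ss_single, prod_singleton, prod_singleton]
  linear_combination (ep i l * ep i l * r i j i l) * ep_sq i j + r i j i l * ep_sq i l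

lemma Rep.contr1_supp {ω : DF n} {r} (h : Rep ω r) (S T : Finset (Fin n))
    (hS : ¬ (S.card = 1 ∧ T.card = 1)) : contr ω S T = 0 := by
  unfold contr
  refine Finset.sum_eq_zero fun i _ => ?_
  split_ifs with hi
  · rfl
  · push Not at hi
    rw [h.supp, mul_zero]
    rw [card_insert_of_notMem hi.1, card_insert_of_notMem hi.2]; omega

lemma Rep.contr2 {ω : DF n} {r} (h : Rep ω r) :
    toScalar (contrN 2 ω) = ∑ j, ∑ i, r i j i j := by
  show contr (contr ω) ∅ ∅ = _
  rw [contr_diag]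
  refine Finset.sum_congr rfl fun i _ => ?_
  simp [h.contr1]

def G (r : Fin n → Fin n → Fin n → Fin n → ℝ) (a b c d x y z w : Fin n) : ℝ :=
  r a b x y * r c d z w

def H (r : Fin n → Fin n → Fin n → Fin n → ℝ) (a b c d x y z w : Fin n) : ℝ :=
  G r a b c d x y z w - G r a b c d x z y w + G r a b c d x w y z + G r a b c d y z x w
   - G r a b c d y w x z + G r a b c d z w x y

def P (r : Fin n → Fin n → Fin n → Fin n → ℝ) (a b c d : Fin n) : ℝ :=
  H r a b c d a b c d - H r a c b d a b c d + H r a d b c a b c d + H r b c a d a b c d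
   - H r b d a c a b c d + H r c d a b a b c d

def E (a b c d : Fin n) : ℝ := ep a b * ep a c * ep a d * ep b c * ep b d * ep c d

lemma E_sq (a b c d : Fin n) : E a b c d * E a b c d = 1 := by
  unfold E
  calc _ = (ep a b * ep a b) * (ep a c * ep a c) * (ep a d * ep a d) * (ep b c * ep b c) *
        (ep b d * ep b d) * (ep c d * ep c d) := by ring
    _ = 1 := by simp only [ep_sq, mul_one]

lemma Rep.term {ω : DF n} {r} (h : Rep ω r) {a b c d x y z w : Fin n} (hab : a ≠ b) (hcd : c ≠ d)
    (hxy : x ≠ y) (hzw : z ≠ w) :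
    shuffleSign {a, b} {c, d} * shuffleSign {x, y} {z, w} * ω {a, b} {x, y} * ω {c, d} {z, w}
     = E a b c d * E x y z w * G r a b c d x y z w := by
  rw [h.val _ _ _ _ hab hxy, h.val _ _ _ _ hcd hzw, ss_pair hab hcd, ss_pair hxy hzw]
  unfold E G; ring

lemma Rep.mul_inner {ω : DF n} {r} (h : Rep ω r) {a b c d x y z w : Fin n}
    (hab : a ≠ b) (hcd : c ≠ d)
    (hxy : x ≠ y) (hxz : x ≠ z) (hxw : x ≠ w) (hyz : y ≠ z) (hyw : y ≠ w) (hzw : z ≠ w) :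
    ∑ C ∈ ({x, y, z, w} : Finset (Fin n)).powerset, shuffleSign {a, b} {c, d} *
      shuffleSign C ({x, y, z, w} \ C) * ω {a, b} C * ω {c, d} ({x, y, z, w} \ C)
     = E a b c d * E x y z w * H r a b c d x y z w := by
  rw [six_sum hxy hxz hxw hyz hyw hzw (fun C D => shuffleSign {a, b} {c, d} *
      shuffleSign C D * ω {a, b} C * ω {c, d} D)
      (fun A B hA => by rw [h.supp {a, b} A (by tauto)]; ring)]
  simp only [h.term hab hcd, hxy, hxz, hxw, hyz, hyw, hzw, ne_eq, not_false_eq_true]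
  unfold H
  simp only [E, ep_swap hxy, ep_swap hxz, ep_swap hxw, ep_swap hyz, ep_swap hyw, ep_swap hzw]
  ring

lemma Rep.mul_diag {ω : DF n} {r} (h : Rep ω r) {x y z w : Fin n}
    (hxy : x ≠ y) (hxz : x ≠ z) (hxw : x ≠ w) (hyz : y ≠ z) (hyw : y ≠ w) (hzw : z ≠ w) :
    mul ω ω {x, y, z, w} {x, y, z, w} = P r x y z w := by
  unfold mul
  rw [six_sum hxy hxz hxw hyz hyw hzw (fun A B =>
    ∑ C ∈ ({x, y, z, w} : Finset (Fin n)).powerset, shuffleSign A B *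
      shuffleSign C ({x, y, z, w} \ C) * ω A C * ω B ({x, y, z, w} \ C))
      (fun A B hA => Finset.sum_eq_zero fun C _ => by rw [h.supp A C (by tauto)]; ring)]
  simp only [h.mul_inner _ _ hxy hxz hxw hyz hyw hzw, hxy, hxz, hxw, hyz, hyw, hzw, ne_eq,
    not_false_eq_true]
  have key := E_sq x y z w
  have s1 : E x z y w = - E x y z w := by simp only [E, ep_swap hyz]; ring
  have s2 : E x w y z = E x y z w := by simp only [E, ep_swap hyw, ep_swap hzw]; ring
  have s3 : E y z x w = E x y z w := by simp only [E, ep_swap hxy, ep_swap hxz]; ring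
  have s4 : E y w x z = - E x y z w := by
    simp only [E, ep_swap hxy, ep_swap hxw, ep_swap hzw]; ring
  have s5 : E z w x y = E x y z w := by
    simp only [E, ep_swap hxz, ep_swap hxw, ep_swap hyz, ep_swap hyw]; ring
  rw [s1, s2, s3, s4, s5]
  unfold P
  linear_combination (H r x y z w x y z w - H r x z y w x y z w + H r x w y z x y z w
    + H r y z x w x y z w - H r y w x z x y z w + H r z w x y x y z w) * key

lemma Rep.P_swap1 {ω : DF n} {r} (h : Rep ω r) (a b c d) : P r b a c d = P r a b c d := by
  simp only [P, H, G, h.anti a b, h.anti2 _ _ a b]; ring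
lemma Rep.P_swap2 {ω : DF n} {r} (h : Rep ω r) (a b c d) : P r a c b d = P r a b c d := by
  simp only [P, H, G, h.anti b c, h.anti2 _ _ b c]; ring
lemma Rep.P_swap3 {ω : DF n} {r} (h : Rep ω r) (a b c d) : P r a b d c = P r a b c d := by
  simp only [P, H, G, h.anti c d, h.anti2 _ _ c d]; ring
lemma Rep.P_zero {ω : DF n} {r} (h : Rep ω r) (a c d) : P r a a c d = 0 := by
  simp only [P, H, G, h.z1, h.z2]; ring

lemma Rep.contr4 {ω : DF n} {r} (h : Rep ω r) :
    toScalar (contrN 4 (pow ω 2)) = ∑ i, ∑ j, ∑ k, ∑ l, P r l k j i := by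
  show contr (contr (contr (contr (mul (mul (one n) ω) ω)))) ∅ ∅ = _
  rw [one_mul', contr_diag]
  refine Finset.sum_congr rfl fun i _ => ?_
  rw [if_neg (by simp), insert_empty_eq, contr_diag]
  refine Finset.sum_congr rfl fun j _ => ?_
  simp only [mem_singleton]
  split_ifs with hji
  · subst hji
    symm
    refine Finset.sum_eq_zero fun k _ => Finset.sum_eq_zero fun l _ => ?_
    rw [h.P_swap2, h.P_swap1, h.P_swap3, h.P_swap2, h.P_zero]
  rw [contr_diag]
  refine Finset.sum_congr rfl fun k _ => ?_
  simp only [mem_insert, mem_singleton]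
  split_ifs with hk
  · symm
    refine Finset.sum_eq_zero fun l _ => ?_
    rcases hk with rfl | rfl
    · rw [h.P_swap1, h.P_swap2, h.P_zero]
    · rw [h.P_swap3, h.P_swap1, h.P_swap2, h.P_zero]
  rw [contr_diag]
  refine Finset.sum_congr rfl fun l _ => ?_
  simp only [mem_insert, mem_singleton]
  push Not at hk
  split_ifs with hl
  · rcases hl with rfl | rfl | rfl
    · rw [h.P_zero]
    · rw [h.P_swap2, h.P_zero]
    · rw [h.P_swap3, h.P_swap2, h.P_zero]
  push Not at hl
  exact h.mul_diag hl.1 hl.2.1 hl.2.2 hk.1 hk.2 hji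

def S4 (F : Fin n → Fin n → Fin n → Fin n → ℝ) : ℝ := ∑ a, ∑ b, ∑ c, ∑ d, F a b c d

lemma sw12 (F : Fin n → Fin n → Fin n → Fin n → ℝ) : S4 (fun a b c d => F b a c d) = S4 F :=
  Finset.sum_comm
lemma sw23 (F : Fin n → Fin n → Fin n → Fin n → ℝ) : S4 (fun a b c d => F a c b d) = S4 F :=
  Finset.sum_congr rfl fun _ _ => Finset.sum_comm
lemma sw34 (F : Fin n → Fin n → Fin n → Fin n → ℝ) : S4 (fun a b c d => F a b d c) = S4 F :=
  Finset.sum_congr rfl fun _ _ => Finset.sum_congr rfl fun _ _ => Finset.sum_comm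
lemma S4_add (F K : Fin n → Fin n → Fin n → Fin n → ℝ) :
    S4 (fun a b c d => F a b c d + K a b c d) = S4 F + S4 K := by
  simp only [S4, Finset.sum_add_distrib]
lemma S4_sub (F K : Fin n → Fin n → Fin n → Fin n → ℝ) :
    S4 (fun a b c d => F a b c d - K a b c d) = S4 F - S4 K := by
  simp only [S4, Finset.sum_sub_distrib]
lemma S4_mul (x : ℝ) (F : Fin n → Fin n → Fin n → Fin n → ℝ) :
    S4 (fun a b c d => x * F a b c d) = x * S4 F := by
  simp only [S4, Finset.mul_sum]

def X (r : Fin n → Fin n → Fin n → Fin n → ℝ) (a b c d : Fin n) : ℝ := r a b a b * r c d c d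
def Y (r : Fin n → Fin n → Fin n → Fin n → ℝ) (a b c d : Fin n) : ℝ := r a b a c * r d b d c
def Z (r : Fin n → Fin n → Fin n → Fin n → ℝ) (a b c d : Fin n) : ℝ := r a b c d * r a b c d

lemma Rep.P_eq {ω : DF n} {r} (h : Rep ω r) (hs : ∀ i j k l, r i j k l = r k l i j) (a b c d) :
    P r a b c d = 2 * (X r a b c d + X r a c b d + X r a d b c)
      - 4 * (Y r a b c d + Y r a b d c + Y r a c d b + Y r b a c d + Y r b a d c + Y r c a b d)
      + 2 * (Z r a b c d + Z r a c b d + Z r a d b c) := by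
  simp only [P, H, G, X, Y, Z, h.anti a b, h.anti a c, h.anti a d, h.anti b c, h.anti b d,
    h.anti c d, h.anti2 _ _ a b, h.anti2 _ _ a c, h.anti2 _ _ a d, h.anti2 _ _ b c,
    h.anti2 _ _ b d, h.anti2 _ _ c d, hs a c a b, hs a d a b, hs b c a b, hs b d a b, hs c d a b,
    hs a d a c, hs b c a c, hs b d a c, hs c d a c, hs b c a d, hs b d a d, hs c d a d,
    hs b d b c, hs c d b c, hs c d b d]
  ring

lemma S4_X (r : Fin n → Fin n → Fin n → Fin n → ℝ) :
    S4 (X r) = (∑ j, ∑ i, r i j i j) ^ 2 := by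
  have : ∑ j, ∑ i, r i j i j = ∑ i, ∑ j, r i j i j := Finset.sum_comm
  rw [this, sq]
  unfold S4 X
  simp only [← Finset.mul_sum, ← Finset.sum_mul]

lemma S4_Y (r : Fin n → Fin n → Fin n → Fin n → ℝ) :
    S4 (Y r) = ∑ j, ∑ l, (∑ i, r i j i l) ^ 2 := by
  rw [← sw12, ← sw23]
  unfold S4 Y
  simp only [sq, ← Finset.mul_sum, ← Finset.sum_mul]

lemma Rep.h4 {ω : DF n} {r} (h : Rep ω r) (hs : ∀ i j k l, r i j k l = r k l i j) :
    h4DF ω = (∑ j, ∑ i, r i j i j) ^ 2 / 4 - ∑ j, ∑ l, (∑ i, r i j i l) ^ 2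
      + S4 (Z r) / 4 := by
  unfold h4DF
  rw [h.contr4]
  have e0 : ∑ i, ∑ j, ∑ k, ∑ l, P r l k j i = S4 (P r) := by
    change S4 (fun i j k l => P r l k j i) = _
    congr 1
    funext i j k l
    rw [h.P_swap1, h.P_swap2, h.P_swap3, h.P_swap1, h.P_swap2, h.P_swap1]
  rw [e0]
  have e1 : P r = fun a b c d => P r a b c d := rfl
  rw [e1]
  simp only [h.P_eq hs, S4_add, S4_sub, S4_mul]
  have x1 : S4 (fun a b c d => X r a c b d) = S4 (X r) := sw23 _
  have x2 : S4 (fun a b c d => X r a d b c) = S4 (X r) :=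
    (sw34 (fun a b c d => X r a c b d)).trans (sw23 _)
  have z1 : S4 (fun a b c d => Z r a c b d) = S4 (Z r) := sw23 _
  have z2 : S4 (fun a b c d => Z r a d b c) = S4 (Z r) :=
    (sw34 (fun a b c d => Z r a c b d)).trans (sw23 _)
  have y1 : S4 (fun a b c d => Y r a b d c) = S4 (Y r) := sw34 _
  have y2 : S4 (fun a b c d => Y r a c d b) = S4 (Y r) :=
    (sw23 (fun a b c d => Y r a b d c)).trans y1
  have y3 : S4 (fun a b c d => Y r b a c d) = S4 (Y r) := sw12 _
  have y4 : S4 (fun a b c d => Y r b a d c) = S4 (Y r) :=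
    (sw12 (fun a b c d => Y r a b d c)).trans y1
  have y5 : S4 (fun a b c d => Y r c a b d) = S4 (Y r) :=
    (sw23 (fun a b c d => Y r b a c d)).trans y3
  have x0 : S4 (fun a b c d => X r a b c d) = S4 (X r) := rfl
  have y0 : S4 (fun a b c d => Y r a b c d) = S4 (Y r) := rfl
  have z0 : S4 (fun a b c d => Z r a b c d) = S4 (Z r) := rfl
  rw [x0, y0, z0, x1, x2, z1, z2, y1, y2, y3, y4, y5, S4_X, S4_Y]
  norm_num [Nat.factorial]
  ring

lemma Rep.norm {ω : DF n} {r} (h : Rep ω r) : dinner ω ω = S4 (Z r) / 4 := by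
  have key : S4 (Z r) = 2 * ∑ S, (2 * ∑ T, ω S T * ω S T) := by
    rw [← pair_sum]
    · unfold S4
      refine Finset.sum_congr rfl fun i _ => Finset.sum_congr rfl fun j _ => ?_
      split_ifs with hij
      · subst hij; simp [Z, h.z1]
      rw [← pair_sum]
      · refine Finset.sum_congr rfl fun k _ => Finset.sum_congr rfl fun l _ => ?_
        split_ifs with hkl
        · subst hkl; simp [Z, h.z2]
        rw [h.val _ _ _ _ hij hkl, Z]
        linear_combination (-(ep k l * ep k l * r i j k l * r i j k l)) * ep_sq i j
          - r i j k l * r i j k l * ep_sq k l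
      · intro T hT
        rw [h.supp _ _ (by tauto)]; ring
    · intro S hS
      rw [Finset.sum_eq_zero, mul_zero]
      intro T _
      rw [h.supp _ _ (by tauto)]; ring
  rw [key, ← Finset.mul_sum]
  unfold dinner
  ring

def dl (i j : Fin n) : ℝ := if i = j then 1 else 0

def KN (b : Fin n → Fin n → ℝ) (i j k l : Fin n) : ℝ :=
  dl i k * b j l + dl j l * b i k - dl i l * b j k - dl j k * b i l

lemma gm_val (i j : Fin n) : gm n {i} {j} = dl i j := by
  simp [gm, dl]

lemma gm_supp (S T : Finset (Fin n)) (h : ¬ (S.card = 1 ∧ T.card = 1)) : gm n S T = 0 := by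
  unfold gm
  rw [if_neg]
  rintro ⟨rfl, h1⟩
  exact h ⟨h1, h1⟩

lemma rep_KN (B : DF n) (hB : ∀ S T, ¬ (S.card = 1 ∧ T.card = 1) → B S T = 0) :
    Rep (mul (gm n) B) (KN fun i j => B {i} {j}) := by
  refine ⟨?_, ?_, ?_, ?_⟩
  · intro S T h
    unfold mul
    refine Finset.sum_eq_zero fun A hA => Finset.sum_eq_zero fun C hC => ?_
    by_cases h1 : A.card = 1 ∧ C.card = 1
    · have c1 := Finset.card_sdiff_add_card_eq_card (Finset.mem_powerset.mp hA)
      have c2 := Finset.card_sdiff_add_card_eq_card (Finset.mem_powerset.mp hC)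
      rw [hB (S \ A) (T \ C) (by omega), mul_zero]
    · rw [gm_supp _ _ h1]; ring
  · intro i j k l hij hkl
    unfold mul
    have inner : ∀ a b : Fin n, ∑ C ∈ ({k, l} : Finset (Fin n)).powerset,
        shuffleSign {a} {b} * shuffleSign C ({k, l} \ C) * gm n {a} C * B {b} ({k, l} \ C)
        = ep a b * ep k l * (dl a k * B {b} {l} - dl a l * B {b} {k}) := by
      intro a b
      rw [two_sum hkl (fun C D => shuffleSign {a} {b} * shuffleSign C D * gm n {a} C * B {b} D)
        (fun A _ hA => by rw [gm_supp {a} A (by tauto)]; ring)]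
      simp only [ss_single, prod_singleton, gm_val, ep_swap hkl]
      ring
    rw [two_sum hij (fun A D => ∑ C ∈ ({k, l} : Finset (Fin n)).powerset,
        shuffleSign A D * shuffleSign C ({k, l} \ C) * gm n A C * B D ({k, l} \ C))
        (fun A _ hA => Finset.sum_eq_zero fun C _ => by rw [gm_supp A C (by tauto)]; ring)]
    rw [inner, inner, ep_swap hij]
    unfold KN
    ring
  · intro i j k l; unfold KN; ring
  · intro i j k l; unfold KN; ring

lemma Rep.sub {ω θ : DF n} {r s} (h : Rep ω r) (h' : Rep θ s) :
    Rep (ω - θ) (fun i j k l => r i j k l - s i j k l) := by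
  refine ⟨?_, ?_, ?_, ?_⟩
  · intro S T hS
    simp [h.supp S T hS, h'.supp S T hS]
  · intro i j k l hij hkl
    simp only [Pi.sub_apply, h.val _ _ _ _ hij hkl, h'.val _ _ _ _ hij hkl]; ring
  · intro i j k l; rw [h.anti, h'.anti]; ring
  · intro i j k l; rw [h.anti2, h'.anti2]; ring

lemma Rep.cross {ω : DF n} {w} (h : Rep ω w) (b : Fin n → Fin n → ℝ) :
    S4 (fun i j k l => w i j k l * KN b i j k l) =
      4 * ∑ j, ∑ l, (∑ i, w i j i l) * b j l := by
  set F : Fin n → Fin n → Fin n → Fin n → ℝ := fun i j k l => w i j k l * (dl i k * b j l)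
    with hF
  have e : (fun i j k l => w i j k l * KN b i j k l) =
      fun i j k l => F i j k l + F j i l k + F i j l k + F j i k l := by
    funext i j k l
    simp only [hF, KN, h.anti i j, h.anti2 i j k l]
    ring
  rw [e]
  simp only [S4_add]
  have f1 : S4 (fun i j k l => F i j l k) = S4 F := sw34 _
  have f2 : S4 (fun i j k l => F j i k l) = S4 F := sw12 _
  have f3 : S4 (fun i j k l => F j i l k) = S4 F := (sw12 (fun i j k l => F i j l k)).trans f1
  have f0 : S4 (fun i j k l => F i j k l) = S4 F := rfl
  rw [f0, f1, f2, f3]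
  have : S4 F = ∑ j, ∑ l, (∑ i, w i j i l) * b j l := by
    rw [← sw12 F, ← sw34]
    unfold S4
    refine Finset.sum_congr rfl fun j _ => ?_
    rw [Finset.sum_comm]
    refine Finset.sum_congr rfl fun l _ => ?_
    rw [Finset.sum_mul]
    refine Finset.sum_congr rfl fun i _ => ?_
    simp [hF, dl]
  rw [this]; ring

lemma KN_trace (b : Fin n → Fin n → ℝ) (j l : Fin n) :
    ∑ i, KN b i j i l = ((n : ℝ) - 2) * b j l + dl j l * ∑ i, b i i := by
  unfold KN
  simp only [Finset.sum_add_distrib, Finset.sum_sub_distrib, ← Finset.mul_sum]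
  simp [dl]
  ring

lemma sigma_two (B : DF n) (hB : ∀ i j : Fin n, B {i} {j} = B {j} {i}) :
    2 * sigma 2 B = (∑ i, B {i} {i}) ^ 2 - ∑ i, ∑ j, B {i} {j} ^ 2 := by
  classical
  have hH : (Matrix.of fun i j => B {i} {j} : Matrix (Fin n) (Fin n) ℝ).IsHermitian := by
    ext i j; simp [hB i j]
  unfold sigma
  rw [dif_pos hH]
  set M := (Matrix.of fun i j => B {i} {j} : Matrix (Fin n) (Fin n) ℝ) with hM
  have t1 : ∑ i, B {i} {i} = ∑ i, hH.eigenvalues i := by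
    have := hH.trace_eq_sum_eigenvalues
    simpa [Matrix.trace, hM] using this
  have t2 : ∑ i, ∑ j, B {i} {j} ^ 2 = ∑ i, hH.eigenvalues i ^ 2 := by
    have a1 : (M * M).trace = ∑ i, ∑ j, B {i} {j} ^ 2 := by
      simp only [Matrix.trace, Matrix.diag, Matrix.mul_apply, hM, Matrix.of_apply]
      refine Finset.sum_congr rfl fun i _ => Finset.sum_congr rfl fun j _ => ?_
      rw [hB j i]; ring
    rw [← a1]
    have sp := hH.spectral_theorem
    have : (M * M).trace = (Matrix.diagonal (RCLike.ofReal ∘ hH.eigenvalues) *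
        Matrix.diagonal (RCLike.ofReal ∘ hH.eigenvalues) : Matrix (Fin n) (Fin n) ℝ).trace := by
      conv_lhs => rw [sp, ← map_mul, Unitary.conjStarAlgAut_apply, Matrix.trace_mul_comm,
        ← mul_assoc]
      simp
    rw [this]
    simp [Matrix.diagonal_mul_diagonal, Matrix.trace_diagonal, sq]
  rw [t1, t2]
  set v := hH.eigenvalues
  have key := pair_sum (n := n) (fun S => if S.card = 2 then ∏ i ∈ S, v i else 0)
    (fun S hS => by simp [hS])
  have e1 : ∑ s ∈ Finset.powersetCard 2 (Finset.univ : Finset (Fin n)), ∏ i ∈ s, v i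
      = ∑ S : Finset (Fin n), if S.card = 2 then ∏ i ∈ S, v i else 0 := by
    rw [← Finset.sum_filter]
    congr 1
    ext S; simp [Finset.mem_powersetCard]
  rw [e1, ← key, sq, Finset.sum_mul_sum, ← Finset.sum_sub_distrib]
  refine Finset.sum_congr rfl fun i _ => ?_
  have : v i ^ 2 = ∑ j, if i = j then v i * v j else 0 := by simp [sq]
  rw [this, ← Finset.sum_sub_distrib]
  refine Finset.sum_congr rfl fun j _ => ?_
  split_ifs with h1 h2
  · ring
  · rw [Finset.prod_pair h1]; ring
  · exact absurd (Finset.card_pair h1) h2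

lemma main_id (hn : 4 ≤ n) {ω : DF n} {r} (h : Rep ω r)
    (hs : ∀ i j k l, r i j k l = r k l i j) (A : DF n)
    (hA : A = (((n : ℝ) - 2)⁻¹ • (contrN 1 ω -
            (toScalar (contrN 2 ω) / (2 * ((n : ℝ) - 1))) • gm n))) :
    h4DF ω = dinner (ω - mul (gm n) A) (ω - mul (gm n) A)
      + 2 * ((n : ℝ) - 2) * ((n : ℝ) - 3) * sigma 2 A := by
  have hn' : (4 : ℝ) ≤ n := by exact_mod_cast hn
  have n2 : (n : ℝ) - 2 ≠ 0 := by linarith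
  have n1 : (n : ℝ) - 1 ≠ 0 := by linarith
  set ρ : Fin n → Fin n → ℝ := fun j l => ∑ i, r i j i l with hρ
  set s : ℝ := ∑ j, ∑ i, r i j i j with hsc
  have hss : s = ∑ j, ρ j j := rfl
  have hAv : ∀ i j, A {i} {j} = ((n : ℝ) - 2)⁻¹ * (ρ i j - s / (2 * ((n : ℝ) - 1)) * dl i j) := by
    intro i j
    rw [hA, h.contr2]
    change _ * (contr ω {i} {j} - _ * gm n {i} {j}) = _
    rw [h.contr1, gm_val]
  have hAs : ∀ S T, ¬ (S.card = 1 ∧ T.card = 1) → A S T = 0 := by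
    intro S T hST
    rw [hA]
    change _ * (contr ω S T - _ * gm n S T) = 0
    rw [h.contr1_supp _ _ hST, gm_supp _ _ hST]; ring
  set b : Fin n → Fin n → ℝ := fun i j => A {i} {j} with hb
  set t : ℝ := ∑ i, b i i with ht
  have hts : s = 2 * ((n : ℝ) - 1) * t := by
    have : t = ((n : ℝ) - 2)⁻¹ * (s - s / (2 * ((n : ℝ) - 1)) * n) := by
      rw [ht]
      simp only [hb, hAv, ← Finset.mul_sum, Finset.sum_sub_distrib, ← hss]
      simp [dl]
    rw [this]; field_simp; ring
  have hρb : ∀ i j, ρ i j = ((n : ℝ) - 2) * b i j + dl i j * t := by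
    intro i j
    simp only [hb, hAv, hts]
    field_simp; ring
  have ρsymm : ∀ i j, ρ i j = ρ j i := fun i j => Finset.sum_congr rfl fun k _ => hs _ _ _ _
  have dsymm : ∀ i j : Fin n, dl i j = dl j i := fun i j => by simp [dl, eq_comm]
  have hsig := sigma_two A (fun i j => by rw [hAv, hAv, ρsymm, dsymm])
  change 2 * sigma 2 A = t ^ 2 - ∑ i, ∑ j, b i j ^ 2 at hsig
  have rk := rep_KN A hAs
  have rw_ := h.sub rk
  rw [h.h4 hs, rw_.norm]
  change s ^ 2 / 4 - ∑ j, ∑ l, ρ j l ^ 2 + S4 (Z r) / 4 = _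
  have c1 := h.cross b
  have c2 := rw_.cross b
  have tr0 : ∀ j l, ∑ i, (r i j i l - KN b i j i l) = 0 := by
    intro j l
    rw [Finset.sum_sub_distrib, KN_trace]
    change ρ j l - _ = 0
    rw [hρb]; ring
  change S4 (fun i j k l => (r i j k l - KN b i j k l) * KN b i j k l)
    = 4 * ∑ j, ∑ l, (∑ i, (r i j i l - KN b i j i l)) * b j l at c2
  simp only [tr0, zero_mul, Finset.sum_const_zero, mul_zero] at c2
  have hZ : S4 (Z fun i j k l => r i j k l - KN b i j k l) = S4 (Z r)
      - S4 (fun i j k l => r i j k l * KN b i j k l)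
      - S4 (fun i j k l => (r i j k l - KN b i j k l) * KN b i j k l) := by
    rw [← S4_sub, ← S4_sub]
    congr 1
    funext i j k l
    simp only [Z]; ring
  change _ = S4 (Z fun i j k l => r i j k l - KN b i j k l) / 4 + _
  rw [hZ, c1, c2]
  set β := ∑ i, ∑ j, b i j ^ 2 with hβ
  have d1 : ∑ j, ∑ l, (∑ i, r i j i l) * b j l = ((n : ℝ) - 2) * β + t ^ 2 := by
    change ∑ j, ∑ l, ρ j l * b j l = _
    have : ∀ j l, ρ j l * b j l = ((n : ℝ) - 2) * b j l ^ 2 + dl j l * (t * b j l) := by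
      intro j l; rw [hρb]; ring
    simp only [this, Finset.sum_add_distrib, ← Finset.mul_sum]
    rw [← hβ]
    simp only [dl, ite_mul, one_mul, zero_mul, Finset.sum_ite_eq, mem_univ, if_true,
      ← Finset.mul_sum]
    rw [← ht]; ring
  have d2 : ∑ j, ∑ l, ρ j l ^ 2 =
      ((n : ℝ) - 2) ^ 2 * β + 2 * ((n : ℝ) - 2) * t ^ 2 + n * t ^ 2 := by
    have : ∀ j l, ρ j l ^ 2 = ((n : ℝ) - 2) ^ 2 * b j l ^ 2
        + dl j l * (2 * ((n : ℝ) - 2) * t * b j l) + dl j l * t ^ 2 := by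
      intro j l; rw [hρb]
      have : dl j l * dl j l = dl j l := by unfold dl; split_ifs <;> norm_num
      linear_combination t ^ 2 * this
    simp only [this, Finset.sum_add_distrib, ← Finset.mul_sum]
    rw [← hβ]
    simp only [dl, ite_mul, one_mul, zero_mul, Finset.sum_ite_eq, mem_univ, if_true,
      ← Finset.mul_sum]
    rw [← ht]
    simp only [Finset.sum_const, Finset.card_univ, Fintype.card_fin, nsmul_eq_mul]
    ring
  rw [d1, d2, hts]
  linear_combination (-((n : ℝ) - 2) * ((n : ℝ) - 3)) * hsig

lemma dinner_nonneg (ω : DF n) : 0 ≤ dinner ω ω :=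
  Finset.sum_nonneg fun _ _ => Finset.sum_nonneg fun _ _ => mul_self_nonneg _

end S12

/-- **σ₂ is the non-Weyl part of h₄.** For an algebraic curvature
tensor `R` with Schouten tensor `A` and Weyl tensor `W = R − gA` (`n ≥ 4`):
`h₄ = |W|² + 2(n−2)(n−3)·σ₂(A)`; in particular `σ₂(A) > 0 → h₄ > 0` and
`σ₂(A) ≥ 0 → h₄ ≥ 0`. -/
theorem stmt12_sigma2_nonWeyl_part_of_h4
    (n : ℕ) (hn : 4 ≤ n)
    (V : Type*) [NormedAddCommGroup V] [InnerProductSpace ℝ V]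
    (hV : Module.finrank ℝ V = n)
    (e : OrthonormalBasis (Fin n) ℝ V)
    (R : V → V → V → V → ℝ) (hR : IsCurv R) :
    (h4DF (ofCurv e R) =
      DF.dinner
        (ofCurv e R - DF.mul (DF.gm n) (((n : ℝ) - 2)⁻¹ •
          (DF.contrN 1 (ofCurv e R) -
            (DF.toScalar (DF.contrN 2 (ofCurv e R)) / (2 * ((n : ℝ) - 1))) • DF.gm n)))
        (ofCurv e R - DF.mul (DF.gm n) (((n : ℝ) - 2)⁻¹ •
          (DF.contrN 1 (ofCurv e R) -
            (DF.toScalar (DF.contrN 2 (ofCurv e R)) / (2 * ((n : ℝ) - 1))) • DF.gm n)))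
      + 2 * ((n : ℝ) - 2) * ((n : ℝ) - 3) *
          DF.sigma 2 (((n : ℝ) - 2)⁻¹ •
            (DF.contrN 1 (ofCurv e R) -
              (DF.toScalar (DF.contrN 2 (ofCurv e R)) / (2 * ((n : ℝ) - 1))) • DF.gm n))) ∧
    (0 < DF.sigma 2 (((n : ℝ) - 2)⁻¹ •
        (DF.contrN 1 (ofCurv e R) -
          (DF.toScalar (DF.contrN 2 (ofCurv e R)) / (2 * ((n : ℝ) - 1))) • DF.gm n)) →
      0 < h4DF (ofCurv e R)) ∧
    (0 ≤ DF.sigma 2 (((n : ℝ) - 2)⁻¹ •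
        (DF.contrN 1 (ofCurv e R) -
          (DF.toScalar (DF.contrN 2 (ofCurv e R)) / (2 * ((n : ℝ) - 1))) • DF.gm n)) →
      0 ≤ h4DF (ofCurv e R)) := by
  have hn' : (4 : ℝ) ≤ n := by exact_mod_cast hn
  have h := S12.main_id hn (S12.rep_curv e R hR) (fun i j k l => hR.pair_symm _ _ _ _) _ rfl
  have hd := S12.dinner_nonneg
    (ofCurv e R - DF.mul (DF.gm n) (((n : ℝ) - 2)⁻¹ •
          (DF.contrN 1 (ofCurv e R) -
            (DF.toScalar (DF.contrN 2 (ofCurv e R)) / (2 * ((n : ℝ) - 1))) • DF.gm n)))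
  have hc : 0 < 2 * ((n : ℝ) - 2) * ((n : ℝ) - 3) := by
    have h2 : 0 < (n : ℝ) - 2 := by linarith
    have h3 : 0 < (n : ℝ) - 3 := by linarith
    positivity
  refine ⟨h, fun hp => ?_, fun hp => ?_⟩
  · rw [h]
    exact add_pos_of_nonneg_of_pos hd (mul_pos hc hp)
  · rw [h]
    exact add_nonneg hd (mul_nonneg hc.le hp)
end

section
/- Second Gauss–Bonnet curvature of a Riemannian product: let R₁ and R₂ be algebraic curvature tensors on real inner product spaces (V₁,g₁) of dimension n₁ and (V₂,g₂) of dimension n₂, and let R = R₁ ⊕ R₂ be the product curvature tensor on the orthogonal direct sum (V₁ ⊕ V₂, g₁ ⊕ g₂), i.e. the unique (2,2)-double form agreeing with R₁ (resp. R₂) on arguments all from V₁ (resp. all from V₂) and vanishing whenever its arguments mix the two factors. Then h₄(R) = h₄(R₁) + (1/2)·Scal(R₁)·Scal(R₂) + h₄(R₂). -/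
/-!
Double forms on an `n`-dimensional real inner product space `(V, g)`, represented
by their components with respect to a (fixed) orthonormal basis: a `(p,q)`-double
form is determined by its values on pairs of increasingly ordered tuples of
distinct basis vectors, i.e. by a function `Finset (Fin n) → Finset (Fin n) → ℝ`
(supported on pairs of sets of cardinalities `p` and `q`).
-/

open Finset

section Comb

variable {n : ℕ}

lemma DFh.sign_sq (A B : Finset (Fin n)) : DF.shuffleSign A B * DF.shuffleSign A B = 1 := by
  unfold DF.shuffleSign
  rw [← mul_pow]; simp

lemma DFh.contr_diag (ω : DF n) (S : Finset (Fin n)) :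
    DF.contr ω S S = ∑ i, if i ∈ S then 0 else ω (insert i S) (insert i S) := by
  unfold DF.contr
  refine Finset.sum_congr rfl fun i _ => ?_
  simp [DFh.sign_sq]

lemma DFh.one_mul (ω : DF n) : DF.mul (DF.one n) ω = ω := by
  funext S T
  unfold DF.mul DF.one
  rw [Finset.sum_eq_single ∅, Finset.sum_eq_single ∅]
  · simp [DF.shuffleSign]
  · intro C _ hC
    simp [hC]
  · simp
  · intro A _ hA
    simp [hA]
  · simp

lemma DFh.pow_two (ω : DF n) : DF.pow ω 2 = DF.mul ω ω := by
  simp [DF.pow, DFh.one_mul]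

lemma DFh.contr4 (ω : DF n) : DF.toScalar (DF.contrN 4 ω) =
    ∑ a, ∑ b, ∑ c, ∑ d, if a ≠ b ∧ a ≠ c ∧ a ≠ d ∧ b ≠ c ∧ b ≠ d ∧ c ≠ d then
      ω {a, b, c, d} {a, b, c, d} else 0 := by
  have h : DF.toScalar (DF.contrN 4 ω) =
    ∑ d, ∑ c, ∑ b, ∑ a, if a ≠ b ∧ a ≠ c ∧ a ≠ d ∧ b ≠ c ∧ b ≠ d ∧ c ≠ d then
      ω {a, b, c, d} {a, b, c, d} else 0 := by
    simp only [DF.toScalar, DF.contrN, Function.iterate_succ, Function.iterate_zero,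
      Function.comp, id, DFh.contr_diag]
    refine Finset.sum_congr rfl fun d _ => ?_
    simp only [Finset.notMem_empty, if_false]
    refine Finset.sum_congr rfl fun c _ => ?_
    by_cases hcd : c = d
    · simp [hcd]
    rw [if_neg (by simpa using hcd)]
    refine Finset.sum_congr rfl fun b _ => ?_
    by_cases hb : b = c ∨ b = d
    · rw [if_pos (by simpa using hb)]
      symm
      apply Finset.sum_eq_zero
      intro a _
      rw [if_neg]
      tauto
    rw [if_neg (by simpa using hb)]
    refine Finset.sum_congr rfl fun a _ => ?_
    push Not at hb
    by_cases ha : a = b ∨ a = c ∨ a = d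
    · rw [if_pos (by simpa using ha), if_neg (by tauto)]
    · rw [if_neg (by simpa using ha), if_pos (by tauto)]
      rfl
  rw [h]
  have e1 : ∀ f : Fin n → Fin n → Fin n → Fin n → ℝ,
      ∑ d, ∑ c, ∑ b, ∑ a, f a b c d = ∑ a, ∑ b, ∑ c, ∑ d, f a b c d := by
    intro f
    calc _ = ∑ d, ∑ c, ∑ a, ∑ b, f a b c d :=
          Finset.sum_congr rfl fun d _ => Finset.sum_congr rfl fun c _ => Finset.sum_comm
      _ = ∑ d, ∑ a, ∑ c, ∑ b, f a b c d :=
          Finset.sum_congr rfl fun d _ => Finset.sum_comm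
      _ = ∑ a, ∑ d, ∑ c, ∑ b, f a b c d := Finset.sum_comm
      _ = ∑ a, ∑ d, ∑ b, ∑ c, f a b c d :=
          Finset.sum_congr rfl fun d _ => Finset.sum_congr rfl fun c _ => Finset.sum_comm
      _ = ∑ a, ∑ b, ∑ d, ∑ c, f a b c d :=
          Finset.sum_congr rfl fun d _ => Finset.sum_comm
      _ = _ := Finset.sum_congr rfl fun d _ => Finset.sum_congr rfl fun c _ => Finset.sum_comm
  exact e1 _

lemma DFh.contr2 (ω : DF n) : DF.toScalar (DF.contrN 2 ω) =
    ∑ a, ∑ b, if a = b then 0 else ω {a, b} {a, b} := by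
  rw [Finset.sum_comm]
  simp only [DF.toScalar, DF.contrN, Function.iterate_succ, Function.iterate_zero,
      Function.comp, id, DFh.contr_diag]
  simp

/-- Sum over subsets of a four-element set of a function supported on pairs. -/
lemma DFh.sum_four (a b c d : Fin n) (hab : a < b) (hbc : b < c) (hcd : c < d)
    (g : Finset (Fin n) → ℝ) (hg : ∀ A, A.card ≠ 2 → g A = 0) :
    ∑ A ∈ ({a, b, c, d} : Finset (Fin n)).powerset, g A =
      g {a, b} + g {a, c} + g {a, d} + g {b, c} + g {b, d} + g {c, d} := by
  have hac := hab.trans hbc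
  have hbd := hbc.trans hcd
  have had := hab.trans hbd
  have z0 : g ∅ = 0 := hg _ (by simp)
  have z1 : ∀ x, g {x} = 0 := fun x => hg _ (by simp)
  have z3 : ∀ x y z, x < y → y < z → g {x, y, z} = 0 := fun x y z h1 h2 => hg _ (by
    rw [Finset.card_eq_three.mpr ⟨x, y, z, h1.ne, (h1.trans h2).ne, h2.ne, rfl⟩]; norm_num)
  have z4 : g {a, b, c, d} = 0 := hg _ (by
    rw [Finset.card_insert_of_notMem (by simp [hab.ne, hac.ne, had.ne]),
      Finset.card_eq_three.mpr ⟨b, c, d, hbc.ne, hbd.ne, hcd.ne, rfl⟩]; norm_num)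
  have s1 : ∀ f : Finset (Fin n) → ℝ, ∑ t ∈ ({d} : Finset (Fin n)).powerset, f t =
      f ∅ + f {d} := by
    intro f
    rw [← insert_empty_eq (β := Finset (Fin n)) d, Finset.sum_powerset_insert (by simp)]
    simp
  have m1 : a ∉ ({b, c, d} : Finset (Fin n)) := by simp [hab.ne, hac.ne, had.ne]
  have m2 : b ∉ ({c, d} : Finset (Fin n)) := by simp [hbc.ne, hbd.ne]
  have m3 : c ∉ ({d} : Finset (Fin n)) := by simp [hcd.ne]
  simp only [Finset.sum_powerset_insert m1, Finset.sum_powerset_insert m2,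
    Finset.sum_powerset_insert m3, s1, insert_empty_eq, z0, z1, z4,
    z3 _ _ _ hab hbc, z3 _ _ _ hab hbd, z3 _ _ _ hac hcd, z3 _ _ _ hbc hcd]
  ring

lemma DFh.sign_pair (p q r s : Fin n) (hpq : p < q) (hrs : r < s) :
    DF.shuffleSign {p, q} {r, s} =
      (if r < p then -1 else 1) * (if s < p then -1 else 1) *
      ((if r < q then -1 else 1) * (if s < q then -1 else 1)) := by
  have key : ∀ x : Fin n, (-1 : ℝ) ^ (Finset.filter (fun b => b < x) {r, s}).card =
      (if r < x then -1 else 1) * (if s < x then -1 else 1) := by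
    intro x
    by_cases h1 : r < x <;> by_cases h2 : s < x <;>
      simp [Finset.filter_insert, Finset.filter_singleton, h1, h2, hrs.ne]
  unfold DF.shuffleSign
  rw [Finset.sum_pair hpq.ne, pow_add, key, key]

/-- Partial contraction polynomial. -/
def DFh.T {ι : Type*} (r : ι → ι → ι → ι → ℝ) (a b c d : ι) : ℝ :=
  r a b a b * r c d c d - r a b a c * r c d b d + r a b a d * r c d b c
    + r a b b c * r c d a d - r a b b d * r c d a c + r a b c d * r c d a b

def DFh.P {ι : Type*} (r : ι → ι → ι → ι → ℝ) (a b c d : ι) : ℝ :=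
  DFh.T r a b c d + DFh.T r a c b d + DFh.T r a d b c
    + DFh.T r b c a d + DFh.T r b d a c + DFh.T r c d a b

lemma DFh.mul_sorted (ω : DF n) (r : Fin n → Fin n → Fin n → Fin n → ℝ)
    (h2 : ∀ a b c d, r a b c d = - r a b d c)
    (hdeg : ∀ A C, A.card ≠ 2 ∨ C.card ≠ 2 → ω A C = 0)
    (hω : ∀ a b c d, a < b → c < d → ω {a, b} {c, d} = r a b c d)
    (a b c d : Fin n) (hab : a < b) (hbc : b < c) (hcd : c < d) :
    DF.mul ω ω {a, b, c, d} {a, b, c, d} = DFh.P r a b c d := by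
  have hac := hab.trans hbc
  have hbd := hbc.trans hcd
  have had := hab.trans hbd
  have nab := hab.not_gt
  have nac := hac.not_gt
  have nad := had.not_gt
  have nbc := hbc.not_gt
  have nbd := hbd.not_gt
  have ncd := hcd.not_gt
  have d1 : ({a, b, c, d} : Finset (Fin n)) \ {a, b} = {c, d} := by ext x; simp; grind
  have d2 : ({a, b, c, d} : Finset (Fin n)) \ {a, c} = {b, d} := by ext x; simp; grind
  have d3 : ({a, b, c, d} : Finset (Fin n)) \ {a, d} = {b, c} := by ext x; simp; grind
  have d4 : ({a, b, c, d} : Finset (Fin n)) \ {b, c} = {a, d} := by ext x; simp; grind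
  have d5 : ({a, b, c, d} : Finset (Fin n)) \ {b, d} = {a, c} := by ext x; simp; grind
  have d6 : ({a, b, c, d} : Finset (Fin n)) \ {c, d} = {a, b} := by ext x; simp; grind
  unfold DF.mul
  rw [DFh.sum_four a b c d hab hbc hcd]
  · have inner : ∀ A : Finset (Fin n), _ := fun A => DFh.sum_four a b c d hab hbc hcd
      (fun C => DF.shuffleSign A ({a, b, c, d} \ A) * DF.shuffleSign C ({a, b, c, d} \ C) *
        ω A C * ω ({a, b, c, d} \ A) ({a, b, c, d} \ C)) (by
        intro C hC; rw [hdeg A C (Or.inr hC)]; ring)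
    rw [inner {a, b}, inner {a, c}, inner {a, d}, inner {b, c}, inner {b, d}, inner {c, d}]
    simp only [d1, d2, d3, d4, d5, d6]
    simp only [hω, DFh.sign_pair, hab, hbc, hcd, hac, hbd, had, nab, nac, nad, nbc, nbd, ncd,
      if_true, if_false]
    unfold DFh.P DFh.T
    simp only [h2 _ _ b a, h2 _ _ c a, h2 _ _ d a, h2 _ _ c b, h2 _ _ d b, h2 _ _ d c]
    ring
  · intro A hA
    apply Finset.sum_eq_zero
    intro C _
    rw [hdeg A C (Or.inl hA)]; ring

lemma DFh.T_swap1 {ι : Type*} (r : ι → ι → ι → ι → ℝ) (h1 : ∀ a b c d, r a b c d = - r b a c d)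
    (h2 : ∀ a b c d, r a b c d = - r a b d c) (a b c d : ι) :
    DFh.T r b a c d = DFh.T r a b c d := by
  unfold DFh.T
  simp only [h1 b a]
  rw [h2 a b b a, h2 c d b a]
  ring

lemma DFh.T_swap3 {ι : Type*} (r : ι → ι → ι → ι → ℝ) (h1 : ∀ a b c d, r a b c d = - r b a c d)
    (h2 : ∀ a b c d, r a b c d = - r a b d c) (a b c d : ι) :
    DFh.T r a b d c = DFh.T r a b c d := by
  unfold DFh.T
  simp only [h1 d c]
  rw [h2 a b d c, h2 c d d c]
  ring

lemma DFh.T_pair {ι : Type*} (r : ι → ι → ι → ι → ℝ)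
    (h2 : ∀ a b c d, r a b c d = - r a b d c) (a b c d : ι) :
    DFh.T r c d a b = DFh.T r a b c d := by
  unfold DFh.T
  rw [h2 c d c a, h2 c d c b, h2 c d d a, h2 c d d b, h2 a b d b, h2 a b d a, h2 a b c b, h2 a b c a]
  ring

section Sym
variable {ι : Type*}

lemma DFh.P_swap1 (r : ι → ι → ι → ι → ℝ) (h1 : ∀ a b c d, r a b c d = - r b a c d)
    (h2 : ∀ a b c d, r a b c d = - r a b d c) (a b c d : ι) :
    DFh.P r b a c d = DFh.P r a b c d := by
  unfold DFh.P
  rw [DFh.T_swap1 r h1 h2 a b c d, DFh.T_swap3 r h1 h2 c d a b]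
  ring

lemma DFh.P_swap2 (r : ι → ι → ι → ι → ℝ) (h1 : ∀ a b c d, r a b c d = - r b a c d)
    (h2 : ∀ a b c d, r a b c d = - r a b d c) (a b c d : ι) :
    DFh.P r a c b d = DFh.P r a b c d := by
  unfold DFh.P
  rw [DFh.T_swap1 r h1 h2 b c a d, DFh.T_swap3 r h1 h2 a d b c]
  ring

lemma DFh.P_swap3 (r : ι → ι → ι → ι → ℝ) (h1 : ∀ a b c d, r a b c d = - r b a c d)
    (h2 : ∀ a b c d, r a b c d = - r a b d c) (a b c d : ι) :
    DFh.P r a b d c = DFh.P r a b c d := by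
  unfold DFh.P
  rw [DFh.T_swap3 r h1 h2 a b c d, DFh.T_swap1 r h1 h2 c d a b]
  ring

lemma DFh.T_zero (r : ι → ι → ι → ι → ℝ) (h1 : ∀ a b c d, r a b c d = - r b a c d)
    (h2 : ∀ a b c d, r a b c d = - r a b d c) (a b c d : ι)
    (h : ¬ (a ≠ b ∧ a ≠ c ∧ a ≠ d ∧ b ≠ c ∧ b ≠ d ∧ c ≠ d)) : DFh.T r a b c d = 0 := by
  have z1 : ∀ x y z, r x x y z = 0 := fun x y z => by linarith [h1 x x y z]
  have z2 : ∀ x y z, r y z x x = 0 := fun x y z => by linarith [h2 y z x x]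
  have hh : a = b ∨ a = c ∨ a = d ∨ b = c ∨ b = d ∨ c = d := by tauto
  unfold DFh.T
  rcases hh with rfl | rfl | rfl | rfl | rfl | rfl
  · simp only [z1]; ring
  · rw [z2, z2, h2 a b b a, h2 a d b a]; ring
  · rw [z2, z2, h2 a b b a, h2 a b c a]
    linear_combination r a b a b * h2 c a c a - r a b a c * h2 c a b a
  · rw [z2, z2]; ring
  · rw [z2, z2, h2 a b c b]
    linear_combination r a b a b * h2 c b c b
  · simp only [z1]; ring

end Sym

/-- A permutation-invariant identity that holds for sorted quadruples holds for all
quadruples of distinct elements. -/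
lemma DFh.sorted_ext (F : Fin n → Fin n → Fin n → Fin n → Prop)
    (s1 : ∀ a b c d, F a b c d → F b a c d)
    (s2 : ∀ a b c d, F a b c d → F a c b d)
    (s3 : ∀ a b c d, F a b c d → F a b d c)
    (hs : ∀ a b c d, a < b → b < c → c < d → F a b c d)
    (a b c d : Fin n) (h : a ≠ b ∧ a ≠ c ∧ a ≠ d ∧ b ≠ c ∧ b ≠ d ∧ c ≠ d) : F a b c d := by
  have H2 : ∀ a b c d : Fin n, a < b → b < c → a ≠ d → b ≠ d → c ≠ d → F a b c d := by
    intro a b c d hab hbc had hbd hcd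
    rcases lt_or_gt_of_ne hcd with h | h
    · exact hs _ _ _ _ hab hbc h
    apply s3
    rcases lt_or_gt_of_ne hbd with h' | h'
    · exact hs _ _ _ _ hab h' h
    apply s2
    rcases lt_or_gt_of_ne had with h'' | h''
    · exact hs _ _ _ _ h'' h' hbc
    apply s1
    exact hs _ _ _ _ h'' hab hbc
  have H3 : ∀ a b c d : Fin n, a < b → a ≠ c → b ≠ c → a ≠ d → b ≠ d → c ≠ d → F a b c d := by
    intro a b c d hab hac hbc had hbd hcd
    rcases lt_or_gt_of_ne hbc with h | h
    · exact H2 _ _ _ _ hab h had hbd hcd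
    apply s2
    rcases lt_or_gt_of_ne hac with h' | h'
    · exact H2 _ _ _ _ h' h had hcd hbd
    apply s1
    exact H2 _ _ _ _ h' hab hcd had hbd
  obtain ⟨hab, hac, had, hbc, hbd, hcd⟩ := h
  rcases lt_or_gt_of_ne hab with h | h
  · exact H3 _ _ _ _ h hac hbc had hbd hcd
  · exact s1 _ _ _ _ (H3 _ _ _ _ h hbc hac hbd had hcd)

def DFh.S {ι : Type*} [Fintype ι] (r : ι → ι → ι → ι → ℝ) : ℝ := ∑ a, ∑ b, r a b a b
def DFh.N {ι : Type*} [Fintype ι] (r : ι → ι → ι → ι → ℝ) : ℝ :=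
  ∑ a, ∑ b, ∑ c, ∑ d, r a b a c * r d c d b
def DFh.M {ι : Type*} [Fintype ι] (r : ι → ι → ι → ι → ℝ) : ℝ :=
  ∑ a, ∑ b, ∑ c, ∑ d, r a b c d * r c d a b

section Sums
variable {ι : Type*} [Fintype ι]

lemma DFh.sc12 (f : ι → ι → ι → ι → ℝ) :
    ∑ a, ∑ b, ∑ c, ∑ d, f b a c d = ∑ a, ∑ b, ∑ c, ∑ d, f a b c d := Finset.sum_comm
lemma DFh.sc23 (f : ι → ι → ι → ι → ℝ) :
    ∑ a, ∑ b, ∑ c, ∑ d, f a c b d = ∑ a, ∑ b, ∑ c, ∑ d, f a b c d :=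
  Finset.sum_congr rfl fun _ _ => Finset.sum_comm
lemma DFh.sc34 (f : ι → ι → ι → ι → ℝ) :
    ∑ a, ∑ b, ∑ c, ∑ d, f a b d c = ∑ a, ∑ b, ∑ c, ∑ d, f a b c d :=
  Finset.sum_congr rfl fun _ _ => Finset.sum_congr rfl fun _ _ => Finset.sum_comm

lemma DFh.sum_T (r : ι → ι → ι → ι → ℝ) (h1 : ∀ a b c d, r a b c d = - r b a c d)
    (h2 : ∀ a b c d, r a b c d = - r a b d c) :
    ∑ a, ∑ b, ∑ c, ∑ d, DFh.T r a b c d = DFh.S r ^ 2 - 4 * DFh.N r + DFh.M r := by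
  have e1 : ∑ a, ∑ b, ∑ c, ∑ d, r a b a b * r c d c d = DFh.S r ^ 2 := by
    simp only [DFh.S, sq, Finset.sum_mul, Finset.mul_sum]
    refine Finset.sum_congr rfl fun a _ => Finset.sum_congr rfl fun b _ =>
      Finset.sum_congr rfl fun c _ => Finset.sum_congr rfl fun d _ => ?_
    ring
  have h12 : ∀ a b c d, r a b c d = r b a d c := fun a b c d => by
    rw [h1, h2]; ring
  have e2 : ∑ a, ∑ b, ∑ c, ∑ d, r a b a c * r c d b d = DFh.N r := by
    unfold DFh.N
    refine Finset.sum_congr rfl fun a _ => Finset.sum_congr rfl fun b _ =>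
      Finset.sum_congr rfl fun c _ => Finset.sum_congr rfl fun d _ => ?_
    rw [h12 c d b d]
  have e3 : ∑ a, ∑ b, ∑ c, ∑ d, r a b a d * r c d b c = - DFh.N r := by
    rw [← DFh.sc34, ← e2]
    simp only [← Finset.sum_neg_distrib]
    refine Finset.sum_congr rfl fun a _ => Finset.sum_congr rfl fun b _ =>
      Finset.sum_congr rfl fun c _ => Finset.sum_congr rfl fun d _ => ?_
    rw [h1 d c]; ring
  have e4 : ∑ a, ∑ b, ∑ c, ∑ d, r a b b c * r c d a d = - DFh.N r := by
    rw [← DFh.sc12, ← e2]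
    simp only [← Finset.sum_neg_distrib]
    refine Finset.sum_congr rfl fun a _ => Finset.sum_congr rfl fun b _ =>
      Finset.sum_congr rfl fun c _ => Finset.sum_congr rfl fun d _ => ?_
    rw [h1 b a]; ring
  have e5 : ∑ a, ∑ b, ∑ c, ∑ d, r a b b d * r c d a c = DFh.N r := by
    rw [← DFh.sc12, ← DFh.sc34, ← e2]
    refine Finset.sum_congr rfl fun a _ => Finset.sum_congr rfl fun b _ =>
      Finset.sum_congr rfl fun c _ => Finset.sum_congr rfl fun d _ => ?_
    rw [h1 b a, h1 d c]; ring
  simp only [DFh.T, Finset.sum_add_distrib, Finset.sum_sub_distrib, e1, e2, e3, e4, e5]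
  unfold DFh.M
  ring

lemma DFh.sum_P (r : ι → ι → ι → ι → ℝ) (h1 : ∀ a b c d, r a b c d = - r b a c d)
    (h2 : ∀ a b c d, r a b c d = - r a b d c) :
    ∑ a, ∑ b, ∑ c, ∑ d, DFh.P r a b c d =
      6 * (DFh.S r ^ 2 - 4 * DFh.N r + DFh.M r) := by
  rw [← DFh.sum_T r h1 h2]
  have p2 := DFh.sc23 (fun a b c d => DFh.T r a b c d)
  have p3 : ∑ a, ∑ b, ∑ c, ∑ d, DFh.T r a d b c = ∑ a, ∑ b, ∑ c, ∑ d, DFh.T r a b c d := by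
    rw [DFh.sc34 (fun a b c d => DFh.T r a c b d), DFh.sc23 (fun a b c d => DFh.T r a b c d)]
  simp only [DFh.P, Finset.sum_add_distrib]
  simp only [fun a b c d => DFh.T_pair r h2 a d b c, fun a b c d => DFh.T_pair r h2 a b c d,
    fun a b c d => DFh.T_pair r h2 a c b d]
  rw [p2, p3]
  ring

end Sums

lemma DFh.h4_eq (ω : DF n) (r : Fin n → Fin n → Fin n → Fin n → ℝ)
    (h1 : ∀ a b c d, r a b c d = - r b a c d)
    (h2 : ∀ a b c d, r a b c d = - r a b d c)
    (hdeg : ∀ A C, A.card ≠ 2 ∨ C.card ≠ 2 → ω A C = 0)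
    (hω : ∀ a b c d, a < b → c < d → ω {a, b} {c, d} = r a b c d) :
    h4DF ω = (DFh.S r ^ 2 - 4 * DFh.N r + DFh.M r) / 4 := by
  unfold h4DF
  have key : DF.toScalar (DF.contrN 4 (DF.pow ω 2)) = ∑ a, ∑ b, ∑ c, ∑ d, DFh.P r a b c d := by
    rw [DFh.contr4, DFh.pow_two]
    refine Finset.sum_congr rfl fun a _ => Finset.sum_congr rfl fun b _ =>
      Finset.sum_congr rfl fun c _ => Finset.sum_congr rfl fun d _ => ?_
    split_ifs with h
    · refine DFh.sorted_ext (fun a b c d => DF.mul ω ω {a, b, c, d} {a, b, c, d} =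
        DFh.P r a b c d) ?_ ?_ ?_ ?_ a b c d h
      · intro a b c d h
        rw [DFh.P_swap1 r h1 h2, ← h, Finset.insert_comm]
      · intro a b c d h
        rw [DFh.P_swap2 r h1 h2, ← h, Finset.insert_comm c b]
      · intro a b c d h
        rw [DFh.P_swap3 r h1 h2, ← h, Finset.pair_comm d c]
      · exact fun a b c d => DFh.mul_sorted ω r h2 hdeg hω a b c d
    · unfold DFh.P
      rw [DFh.T_zero r h1 h2, DFh.T_zero r h1 h2, DFh.T_zero r h1 h2, DFh.T_zero r h1 h2,
        DFh.T_zero r h1 h2, DFh.T_zero r h1 h2]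
      · ring
      all_goals (intro h'; apply h; grind)
  rw [key, DFh.sum_P r h1 h2]
  norm_num [Nat.factorial]
  ring

lemma DFh.scal_eq (ω : DF n) (r : Fin n → Fin n → Fin n → Fin n → ℝ)
    (h1 : ∀ a b c d, r a b c d = - r b a c d)
    (h2 : ∀ a b c d, r a b c d = - r a b d c)
    (hω : ∀ a b c d, a < b → c < d → ω {a, b} {c, d} = r a b c d) :
    scalDF ω = DFh.S r := by
  unfold scalDF DFh.S
  rw [DFh.contr2]
  refine Finset.sum_congr rfl fun a _ => Finset.sum_congr rfl fun b _ => ?_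
  split_ifs with h
  · subst h; linarith [h1 a a a a]
  · rcases lt_or_gt_of_ne h with h | h
    · exact hω _ _ _ _ h h
    · rw [Finset.pair_comm, hω _ _ _ _ h h, h1, h2]; ring

end Comb

section Geo

variable {V : Type*} [NormedAddCommGroup V] [InnerProductSpace ℝ V]

lemma DFh.orderIso_pair {n : ℕ} (a b : Fin n) (hab : a < b) (h : ({a, b} : Finset (Fin n)).card = 2) :
    ((({a, b} : Finset (Fin n)).orderIsoOfFin h 0 : Fin n) = a) ∧
    ((({a, b} : Finset (Fin n)).orderIsoOfFin h 1 : Fin n) = b) := by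
  have := Finset.orderEmbOfFin_unique h (f := ![a, b]) (by
    intro x; fin_cases x <;> simp) (by
    intro x y hxy
    fin_cases x <;> fin_cases y <;> simp_all)
  have e0 := congrFun this 0
  have e1 := congrFun this 1
  simp only [Finset.coe_orderIsoOfFin_apply]
  exact ⟨e0.symm, e1.symm⟩

lemma DFh.ofCurv_deg {n : ℕ} (e : OrthonormalBasis (Fin n) ℝ V) (R : V → V → V → V → ℝ)
    (A C : Finset (Fin n)) (h : A.card ≠ 2 ∨ C.card ≠ 2) : ofCurv e R A C = 0 := by
  unfold ofCurv ofForm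
  rw [dif_neg (by tauto)]

lemma DFh.ofCurv_pair {n : ℕ} (e : OrthonormalBasis (Fin n) ℝ V) (R : V → V → V → V → ℝ)
    (a b c d : Fin n) (hab : a < b) (hcd : c < d) :
    ofCurv e R {a, b} {c, d} = R (e a) (e b) (e c) (e d) := by
  have ha := Finset.card_pair hab.ne
  have hc := Finset.card_pair hcd.ne
  unfold ofCurv ofForm
  rw [dif_pos ⟨ha, hc⟩]
  simp only [(DFh.orderIso_pair a b hab ha).1, (DFh.orderIso_pair a b hab ha).2,
    (DFh.orderIso_pair c d hcd hc).1, (DFh.orderIso_pair c d hcd hc).2]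

lemma DFh.antisymm2 {R : V → V → V → V → ℝ} (hR : IsCurv R) (x y z w : V) :
    R x y z w = - R x y w z := by
  rw [hR.pair_symm, hR.antisymm, hR.pair_symm]

/-- Components in a family of vectors. -/
def DFh.comp {ι : Type*} (R : V → V → V → V → ℝ) (e : ι → V) : ι → ι → ι → ι → ℝ :=
  fun a b c d => R (e a) (e b) (e c) (e d)

lemma DFh.h4_curv {n : ℕ} (e : OrthonormalBasis (Fin n) ℝ V) {R : V → V → V → V → ℝ}
    (hR : IsCurv R) : h4DF (ofCurv e R) =
      (DFh.S (DFh.comp R e) ^ 2 - 4 * DFh.N (DFh.comp R e) + DFh.M (DFh.comp R e)) / 4 :=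
  DFh.h4_eq _ _ (fun _ _ _ _ => hR.antisymm _ _ _ _) (fun _ _ _ _ => DFh.antisymm2 hR _ _ _ _)
    (DFh.ofCurv_deg e R) (DFh.ofCurv_pair e R)

lemma DFh.scal_curv {n : ℕ} (e : OrthonormalBasis (Fin n) ℝ V) {R : V → V → V → V → ℝ}
    (hR : IsCurv R) : scalDF (ofCurv e R) = DFh.S (DFh.comp R e) :=
  DFh.scal_eq _ _ (fun _ _ _ _ => hR.antisymm _ _ _ _) (fun _ _ _ _ => DFh.antisymm2 hR _ _ _ _)
    (DFh.ofCurv_pair e R)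

lemma DFh.trace_indep {ι κ : Type*} [Fintype ι] [Fintype κ] (e : OrthonormalBasis ι ℝ V)
    (f : OrthonormalBasis κ ℝ V) (b : V → V → ℝ) (hb : IsBilin b) :
    ∑ i, b (e i) (e i) = ∑ j, b (f j) (f j) := by
  haveI : FiniteDimensional ℝ V := e.toBasis.finiteDimensional_of_finite
  have l0 : ∀ y, b 0 y = 0 := fun y => by have := hb.1 1 0 0 y; simp at this; exact this
  have r0 : ∀ x, b x 0 = 0 := fun x => by have := hb.2 1 x 0 0; simp at this; exact this
  let B : V →ₗ[ℝ] V →ₗ[ℝ] ℝ := LinearMap.mk₂ ℝ b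
    (fun x x' y => by simpa using hb.1 1 x x' y)
    (fun c x y => by simpa [l0] using hb.1 c x 0 y)
    (fun x y y' => by simpa using hb.2 1 x y y')
    (fun c x y => by simpa [r0] using hb.2 c x y 0)
  have h := (InnerProductSpace.canonicalCovariantTensor_eq_sum V e).symm.trans
    (InnerProductSpace.canonicalCovariantTensor_eq_sum V f)
  have h' := congrArg (TensorProduct.lift B) h
  simpa [B] using h'

lemma DFh.bilin_sum {κ : Type*} [Fintype κ] (b : κ → V → V → ℝ) (hb : ∀ k, IsBilin (b k)) :
    IsBilin fun x y => ∑ k, b k x y := by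
  constructor
  · intro c x x' y
    simp only [(hb _).1, Finset.sum_add_distrib, Finset.mul_sum]
  · intro c x x' y
    simp only [(hb _).2, Finset.sum_add_distrib, Finset.mul_sum]

section Indep
variable {ι κ : Type*} [Fintype ι] [Fintype κ] (e : OrthonormalBasis ι ℝ V)
    (f : OrthonormalBasis κ ℝ V)

lemma DFh.trace4_indep (G : V → V → V → V → V → V → V → V → ℝ)
    (g1 : ∀ x2 y2 x3 y3 x4 y4, IsBilin fun x y => G x y x2 y2 x3 y3 x4 y4)
    (g2 : ∀ x1 y1 x3 y3 x4 y4, IsBilin fun x y => G x1 y1 x y x3 y3 x4 y4)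
    (g3 : ∀ x1 y1 x2 y2 x4 y4, IsBilin fun x y => G x1 y1 x2 y2 x y x4 y4)
    (g4 : ∀ x1 y1 x2 y2 x3 y3, IsBilin fun x y => G x1 y1 x2 y2 x3 y3 x y) :
    ∑ a, ∑ b, ∑ c, ∑ d, G (e a) (e a) (e b) (e b) (e c) (e c) (e d) (e d) =
    ∑ a, ∑ b, ∑ c, ∑ d, G (f a) (f a) (f b) (f b) (f c) (f c) (f d) (f d) := by
  have t4 : ∀ x1 y1 x2 y2 x3 y3, ∑ d, G x1 y1 x2 y2 x3 y3 (e d) (e d) =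
      ∑ d, G x1 y1 x2 y2 x3 y3 (f d) (f d) := fun x1 y1 x2 y2 x3 y3 =>
    DFh.trace_indep e f (fun x y => G x1 y1 x2 y2 x3 y3 x y) (g4 _ _ _ _ _ _)
  have t3 : ∀ x1 y1 x2 y2, ∑ c, ∑ d, G x1 y1 x2 y2 (e c) (e c) (f d) (f d) =
      ∑ c, ∑ d, G x1 y1 x2 y2 (f c) (f c) (f d) (f d) := fun x1 y1 x2 y2 =>
    DFh.trace_indep e f (fun x y => ∑ d, G x1 y1 x2 y2 x y (f d) (f d))
      (DFh.bilin_sum _ fun _ => g3 _ _ _ _ _ _)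
  have t2 : ∀ x1 y1, ∑ b, ∑ c, ∑ d, G x1 y1 (e b) (e b) (f c) (f c) (f d) (f d) =
      ∑ b, ∑ c, ∑ d, G x1 y1 (f b) (f b) (f c) (f c) (f d) (f d) := fun x1 y1 =>
    DFh.trace_indep e f (fun x y => ∑ c, ∑ d, G x1 y1 x y (f c) (f c) (f d) (f d))
      (DFh.bilin_sum _ fun _ => DFh.bilin_sum _ fun _ => g2 _ _ _ _ _ _)
  simp only [t4, t3, t2]
  exact DFh.trace_indep e f (fun x y => ∑ b, ∑ c, ∑ d, G x y (f b) (f b) (f c) (f c) (f d) (f d))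
      (DFh.bilin_sum _ fun _ => DFh.bilin_sum _ fun _ => DFh.bilin_sum _ fun _ => g1 _ _ _ _ _ _)

variable {R : V → V → V → V → ℝ}

lemma DFh.lin2 (hR : IsCurv R) (c : ℝ) (x y y' z w : V) :
    R x (c • y + y') z w = c * R x y z w + R x y' z w := by
  rw [hR.antisymm, hR.linear, hR.antisymm y, hR.antisymm y']; ring
lemma DFh.lin3 (hR : IsCurv R) (c : ℝ) (x y z z' w : V) :
    R x y (c • z + z') w = c * R x y z w + R x y z' w := by
  rw [hR.pair_symm, hR.linear, hR.pair_symm z, hR.pair_symm z']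
lemma DFh.lin4 (hR : IsCurv R) (c : ℝ) (x y z w w' : V) :
    R x y z (c • w + w') = c * R x y z w + R x y z w' := by
  rw [hR.pair_symm, DFh.lin2 hR, hR.pair_symm z, hR.pair_symm z]

lemma DFh.S_indep (hR : IsCurv R) : DFh.S (DFh.comp R e) = DFh.S (DFh.comp R f) := by
  unfold DFh.S DFh.comp
  have t2 : ∀ x y : V, ∑ b, R x (e b) y (e b) = ∑ b, R x (f b) y (f b) := fun x y =>
    DFh.trace_indep e f (fun u v => R x u y v)
      ⟨fun _ _ _ _ => DFh.lin2 hR .., fun _ _ _ _ => DFh.lin4 hR ..⟩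
  simp only [t2]
  exact DFh.trace_indep e f (fun u v => ∑ b, R u (f b) v (f b)) (DFh.bilin_sum _ fun _ =>
      ⟨fun _ _ _ _ => hR.linear .., fun _ _ _ _ => DFh.lin3 hR ..⟩)

lemma DFh.N_indep (hR : IsCurv R) : DFh.N (DFh.comp R e) = DFh.N (DFh.comp R f) := by
  refine DFh.trace4_indep e f (fun a a' b b' c c' d d' => R a b a' c * R d c' d' b') ?_ ?_ ?_ ?_
  all_goals
    intros
    constructor
    all_goals
      intros
      simp only [hR.linear, DFh.lin2 hR, DFh.lin3 hR, DFh.lin4 hR]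
      ring

lemma DFh.M_indep (hR : IsCurv R) : DFh.M (DFh.comp R e) = DFh.M (DFh.comp R f) := by
  refine DFh.trace4_indep e f (fun a a' b b' c c' d d' => R a b c d * R c' d' a' b') ?_ ?_ ?_ ?_
  all_goals
    intros
    constructor
    all_goals
      intros
      simp only [hR.linear, DFh.lin2 hR, DFh.lin3 hR, DFh.lin4 hR]
      ring

end Indep

end Geo

/-- **h₄ of a Riemannian product.** Let `R₁, R₂` be algebraic curvature
tensors on `(V₁,g₁)`, `(V₂,g₂)` and let `R` be the product curvature tensor on the
orthogonal direct sum `(V₁ ⊕ V₂, g₁ ⊕ g₂)` (the unique `(2,2)`-double form agreeing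
with `R₁`, resp. `R₂`, on arguments from `V₁`, resp. `V₂`, and vanishing on mixed
arguments; equivalently `R(x,y;z,w) = R₁(x₁,y₁;z₁,w₁) + R₂(x₂,y₂;z₂,w₂)`). Then
`h₄(R) = h₄(R₁) + (1/2)·Scal(R₁)·Scal(R₂) + h₄(R₂)`. -/
theorem stmt13_h4_of_product
    (n₁ n₂ : ℕ)
    (V₁ : Type*) [NormedAddCommGroup V₁] [InnerProductSpace ℝ V₁]
    (V₂ : Type*) [NormedAddCommGroup V₂] [InnerProductSpace ℝ V₂]
    (hV₁ : Module.finrank ℝ V₁ = n₁) (hV₂ : Module.finrank ℝ V₂ = n₂)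
    (e₁ : OrthonormalBasis (Fin n₁) ℝ V₁) (e₂ : OrthonormalBasis (Fin n₂) ℝ V₂)
    (e : OrthonormalBasis (Fin (n₁ + n₂)) ℝ (WithLp 2 (V₁ × V₂)))
    (R₁ : V₁ → V₁ → V₁ → V₁ → ℝ) (hR₁ : IsCurv R₁)
    (R₂ : V₂ → V₂ → V₂ → V₂ → ℝ) (hR₂ : IsCurv R₂)
    (R : WithLp 2 (V₁ × V₂) → WithLp 2 (V₁ × V₂) → WithLp 2 (V₁ × V₂) →
      WithLp 2 (V₁ × V₂) → ℝ)
    (hR : ∀ x y z w, R x y z w =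
      R₁ (WithLp.equiv 2 (V₁ × V₂) x).1 (WithLp.equiv 2 (V₁ × V₂) y).1
         (WithLp.equiv 2 (V₁ × V₂) z).1 (WithLp.equiv 2 (V₁ × V₂) w).1
      + R₂ (WithLp.equiv 2 (V₁ × V₂) x).2 (WithLp.equiv 2 (V₁ × V₂) y).2
           (WithLp.equiv 2 (V₁ × V₂) z).2 (WithLp.equiv 2 (V₁ × V₂) w).2) :
    h4DF (ofCurv e R) =
      h4DF (ofCurv e₁ R₁) + (1 / 2) * scalDF (ofCurv e₁ R₁) * scalDF (ofCurv e₂ R₂)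
        + h4DF (ofCurv e₂ R₂) := by
  have z1 : ∀ y z w, R₁ 0 y z w = 0 := fun y z w => by
    have := hR₁.linear 1 0 0 y z w; simp at this; exact this
  have z1b : ∀ y z w, R₁ y 0 z w = 0 := fun y z w => by rw [hR₁.antisymm, z1, neg_zero]
  have z1c : ∀ y z w, R₁ y z 0 w = 0 := fun y z w => by rw [hR₁.pair_symm, z1]
  have z1d : ∀ y z w, R₁ y z w 0 = 0 := fun y z w => by rw [hR₁.pair_symm, z1b]
  have z2 : ∀ y z w, R₂ 0 y z w = 0 := fun y z w => by
    have := hR₂.linear 1 0 0 y z w; simp at this; exact this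
  have z2b : ∀ y z w, R₂ y 0 z w = 0 := fun y z w => by rw [hR₂.antisymm, z2, neg_zero]
  have z2c : ∀ y z w, R₂ y z 0 w = 0 := fun y z w => by rw [hR₂.pair_symm, z2]
  have z2d : ∀ y z w, R₂ y z w 0 = 0 := fun y z w => by rw [hR₂.pair_symm, z2b]
  have hRc : IsCurv R := by
    constructor
    · intro c x x' y z w
      simp only [hR]
      have k1 : (WithLp.equiv 2 (V₁ × V₂) (c • x + x')).1 =
        c • (WithLp.equiv 2 (V₁ × V₂) x).1 + (WithLp.equiv 2 (V₁ × V₂) x').1 := rfl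
      have k2 : (WithLp.equiv 2 (V₁ × V₂) (c • x + x')).2 =
        c • (WithLp.equiv 2 (V₁ × V₂) x).2 + (WithLp.equiv 2 (V₁ × V₂) x').2 := rfl
      rw [k1, k2, hR₁.linear, hR₂.linear]
      ring
    · intro x y z w
      rw [hR, hR, hR₁.antisymm, hR₂.antisymm]; ring
    · intro x y z w
      rw [hR, hR, hR₁.pair_symm, hR₂.pair_symm]
    · intro x y z w
      rw [hR, hR, hR]
      linarith [hR₁.bianchi (WithLp.equiv 2 (V₁ × V₂) x).1 (WithLp.equiv 2 (V₁ × V₂) y).1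
         (WithLp.equiv 2 (V₁ × V₂) z).1 (WithLp.equiv 2 (V₁ × V₂) w).1,
        hR₂.bianchi (WithLp.equiv 2 (V₁ × V₂) x).2 (WithLp.equiv 2 (V₁ × V₂) y).2
         (WithLp.equiv 2 (V₁ × V₂) z).2 (WithLp.equiv 2 (V₁ × V₂) w).2]
  set f := e₁.prod e₂ with hf
  have f1 : ∀ i, (WithLp.equiv 2 (V₁ × V₂) (f (Sum.inl i))) = (e₁ i, 0) := fun i => by simp [hf]
  have f2 : ∀ i, (WithLp.equiv 2 (V₁ × V₂) (f (Sum.inr i))) = (0, e₂ i) := fun i => by simp [hf]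
  have hS : DFh.S (DFh.comp R f) = DFh.S (DFh.comp R₁ e₁) + DFh.S (DFh.comp R₂ e₂) := by
    simp only [DFh.S, DFh.comp, Fintype.sum_sum_type, hR, f1, f2, z1, z1b, z1c, z1d, z2, z2b,
      z2c, z2d, add_zero, zero_add, mul_zero, zero_mul, Finset.sum_const_zero]
  have hN : DFh.N (DFh.comp R f) = DFh.N (DFh.comp R₁ e₁) + DFh.N (DFh.comp R₂ e₂) := by
    simp only [DFh.N, DFh.comp, Fintype.sum_sum_type, hR, f1, f2, z1, z1b, z1c, z1d, z2, z2b,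
      z2c, z2d, add_zero, zero_add, mul_zero, zero_mul, Finset.sum_const_zero]
  have hM : DFh.M (DFh.comp R f) = DFh.M (DFh.comp R₁ e₁) + DFh.M (DFh.comp R₂ e₂) := by
    simp only [DFh.M, DFh.comp, Fintype.sum_sum_type, hR, f1, f2, z1, z1b, z1c, z1d, z2, z2b,
      z2c, z2d, add_zero, zero_add, mul_zero, zero_mul, Finset.sum_const_zero]
  rw [DFh.h4_curv e hRc, DFh.h4_curv e₁ hR₁, DFh.h4_curv e₂ hR₂, DFh.scal_curv e₁ hR₁,
    DFh.scal_curv e₂ hR₂, DFh.S_indep e f hRc, DFh.N_indep e f hRc, DFh.M_indep e f hRc, hS, hN, hM]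
  ring
end
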